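/- arXiv:1609.01083 — 3 statements merged into one kernel-verified Lean document; each statement's English description precedes it below -/
import Mathlib

section
/- Let d ≥ 1 and let φ : [0,∞) → ℂ be a compactly supported C^{⌊d/2⌋+4} function. For k ∈ ℤ and f ∈ ℓ¹(ℤ^d) define M_k f(n) := ∫_{𝕋^d} φ(2^{-k} Sin(ξ)) 𝓕f(ξ) e^{−2π i n·ξ} dξ. Then for every 1 < p < ∞ there is a constant C = C(d,p,φ) such that for all f ∈ ℓ¹(ℤ^d), ‖ sup_{k∈ℤ} |M_k f| ‖_{ℓ^p(ℤ^d)} ≤ C ‖f‖_{ℓ^p(ℤ^d)}. -/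
open MeasureTheory Real
open scoped ENNReal NNReal

/-- The function `Sin(ξ) = (4 ∑_j sin²(π ξ_j))^{1/2}` on `ℝ^d`. -/
noncomputable def SinD (d : ℕ) (ξ : Fin d → ℝ) : ℝ :=
  Real.sqrt (4 * ∑ j, Real.sin (Real.pi * ξ j) ^ 2)

/-- The torus `𝕋^d = [-1/2, 1/2]^d`. -/
noncomputable def Td (d : ℕ) : Set (Fin d → ℝ) :=
  Set.univ.pi fun _ => Set.Icc (-(1 : ℝ) / 2) (1 / 2)

/-- The Fourier transform of `f ∈ ℓ¹(ℤ^d)`. -/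
noncomputable def Ftd (d : ℕ) (f : (Fin d → ℤ) → ℂ) (ξ : Fin d → ℝ) : ℂ :=
  ∑' n : Fin d → ℤ,
    f n * Complex.exp (2 * Real.pi * Complex.I * ∑ j, (n j : ℂ) * (ξ j : ℂ))

/-- The `ℓ^p(ℤ^d)` norm, valued in `ℝ≥0∞`. -/
noncomputable def lpN (d : ℕ) (p : ℝ) (f : (Fin d → ℤ) → ℂ) : ℝ≥0∞ :=
  (∑' n : Fin d → ℤ, (‖f n‖₊ : ℝ≥0∞) ^ p) ^ (1 / p)

/-- The dilated multiplier piece `M_k f(n) = ∫_{𝕋^d} φ(2^{-k} Sin ξ) 𝓕f(ξ) e^{-2πi n·ξ} dξ`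
associated with the discrete Laplacian. -/
noncomputable def MpieceZ (d : ℕ) (φ : ℝ → ℂ) (k : ℤ) (f : (Fin d → ℤ) → ℂ)
    (n : Fin d → ℤ) : ℂ :=
  ∫ ξ in Td d,
    φ ((2 : ℝ) ^ (-k) * SinD d ξ) * Ftd d f ξ *
      Complex.exp (-(2 * Real.pi * Complex.I) * ∑ j, (n j : ℂ) * (ξ j : ℂ))

/-- The label of the dyadic cube of side `2 ^ q` containing `n`. -/
def coarse {d : ℕ} (q : ℕ) (n : Fin d → ℤ) : Fin d → ℤ := fun i => n i / 2 ^ q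

/-- The dyadic cube of side `2 ^ q` containing `n`. -/
noncomputable def cube {d : ℕ} (q : ℕ) (n : Fin d → ℤ) : Finset (Fin d → ℤ) :=
  Fintype.piFinset fun i => Finset.Ico (n i / 2 ^ q * 2 ^ q) (n i / 2 ^ q * 2 ^ q + 2 ^ q)

lemma mem_cube {d : ℕ} {q : ℕ} {n x : Fin d → ℤ} : x ∈ cube q n ↔ coarse q x = coarse q n := by
  simp only [cube, Fintype.mem_piFinset, Finset.mem_Ico, coarse, funext_iff]
  refine forall_congr' fun i => ?_
  have h2 : (0 : ℤ) < 2 ^ q := by positivity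
  constructor
  · rintro ⟨h, h'⟩
    exact le_antisymm (Int.lt_add_one_iff.1 (Int.ediv_lt_of_lt_mul h2 (by linarith)))
      (Int.le_ediv_of_mul_le h2 h)
  · intro h
    rw [← h]
    exact ⟨Int.ediv_mul_le _ h2.ne', Int.lt_ediv_add_one_mul_self (x i) h2 |>.trans_eq (by ring)⟩

lemma card_cube {d : ℕ} (q : ℕ) (n : Fin d → ℤ) : (cube q n).card = 2 ^ (q * d) := by
  have h : ((2 : ℤ) ^ q).toNat = 2 ^ q := by
    rw [show (2 : ℤ) ^ q = ((2 ^ q : ℕ) : ℤ) by push_cast; rfl, Int.toNat_natCast]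
  simp [cube, Fintype.card_piFinset, pow_mul, h]

lemma mem_cube_comm {d : ℕ} {q : ℕ} {n x : Fin d → ℤ} : x ∈ cube q n ↔ n ∈ cube q x := by
  rw [mem_cube, mem_cube, eq_comm]

lemma cube_zero {d : ℕ} (n : Fin d → ℤ) : cube 0 n = {n} := by
  ext x; rw [mem_cube, Finset.mem_singleton]; simp [coarse, funext_iff]

lemma coarse_congr_of_le {d : ℕ} {q r : ℕ} (h : q ≤ r) {n x : Fin d → ℤ}
    (hx : coarse q x = coarse q n) : coarse r x = coarse r n := by
  obtain ⟨s, rfl⟩ := Nat.exists_eq_add_of_le h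
  funext i
  have := congrFun hx i
  simp only [coarse] at this ⊢
  rw [pow_add, ← Int.ediv_ediv_of_nonneg (by positivity), this,
    Int.ediv_ediv_of_nonneg (by positivity)]

/-- The average of `F` over the dyadic cube of side `2 ^ q` containing `n`. -/
noncomputable def cubeAvg {d : ℕ} (F : (Fin d → ℤ) → ℝ≥0∞) (q : ℕ) (n : Fin d → ℤ) : ℝ≥0∞ :=
  (2 ^ (q * d))⁻¹ * ∑ x ∈ cube q n, F x

lemma cubeAvg_congr {d : ℕ} (F : (Fin d → ℤ) → ℝ≥0∞) {q r : ℕ} (h : q ≤ r) {n x : Fin d → ℤ}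
    (hx : coarse q x = coarse q n) : cubeAvg F r x = cubeAvg F r n := by
  have : cube r x = cube r n := by
    ext y; rw [mem_cube, mem_cube, coarse_congr_of_le h hx]
  rw [cubeAvg, cubeAvg, this]

lemma cubeAvg_le_succ {d : ℕ} (F : (Fin d → ℤ) → ℝ≥0∞) (q : ℕ) (n : Fin d → ℤ) :
    cubeAvg F q n ≤ 2 ^ d * cubeAvg F (q + 1) n := by
  have hs : cube q n ⊆ cube (q + 1) n := fun x hx =>
    mem_cube.2 (coarse_congr_of_le q.le_succ (mem_cube.1 hx))
  rw [cubeAvg, cubeAvg, add_mul, one_mul, pow_add, ENNReal.mul_inv (by simp) (by simp),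
    mul_comm (2 ^ (q * d))⁻¹ (2 ^ d)⁻¹, ← mul_assoc, ← mul_assoc,
    ENNReal.mul_inv_cancel (by simp) (by simp), one_mul]
  gcongr

open Classical in
/-- The largest `q ≤ N` such that the cube of side `2 ^ q` around `n` has average above `t`, and
`0` if there is none. -/
noncomputable def level {d : ℕ} (F : (Fin d → ℤ) → ℝ≥0∞) (t : ℝ≥0∞) (N : ℕ) (n : Fin d → ℤ) : ℕ :=
  Nat.findGreatest (fun q => t < cubeAvg F q n) N

section level
variable {d : ℕ} {F : (Fin d → ℤ) → ℝ≥0∞} {t : ℝ≥0∞} {N : ℕ}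

lemma cubeAvg_le_of_level_lt (hN : ∀ q, N < q → ∀ n, cubeAvg F q n ≤ t) {n : Fin d → ℤ} {q : ℕ}
    (hq : level F t N n < q) : cubeAvg F q n ≤ t := by
  classical
  rcases le_or_gt q N with h | h
  · exact not_lt.1 (Nat.findGreatest_is_greatest hq h)
  · exact hN q h n

lemma level_eq_zero_or (n : Fin d → ℤ) :
    level F t N n = 0 ∨ t < cubeAvg F (level F t N n) n := by
  classical
  by_cases h : level F t N n = 0
  · exact Or.inl h
  · exact Or.inr (Nat.findGreatest_of_ne_zero (P := fun q => t < cubeAvg F q n) rfl h)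

lemma level_congr {n x : Fin d → ℤ} (hx : x ∈ cube (level F t N n) n) :
    level F t N x = level F t N n := by
  classical
  rcases level_eq_zero_or (F := F) (t := t) (N := N) n with h | h
  · rw [h, cube_zero, Finset.mem_singleton] at hx
    rw [hx]
  · have hle : level F t N n ≤ level F t N x :=
      Nat.le_findGreatest (Nat.findGreatest_le N) (by rwa [cubeAvg_congr F le_rfl (mem_cube.1 hx)])
    refine le_antisymm ?_ hle
    by_contra hc
    rw [not_le] at hc
    have h1 := (level_eq_zero_or (F := F) (t := t) (N := N) x).resolve_left (by omega)
    rw [cubeAvg_congr F hle (mem_cube.1 hx)] at h1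
    exact Nat.findGreatest_is_greatest hc (Nat.findGreatest_le N) h1

lemma cubeAvg_level_le (hN : ∀ q, N < q → ∀ n, cubeAvg F q n ≤ t) (n : Fin d → ℤ) :
    cubeAvg F (level F t N n) n ≤ 2 ^ d * t :=
  (cubeAvg_le_succ F _ n).trans (by gcongr; exact cubeAvg_le_of_level_lt hN (Nat.lt_succ_self _))

lemma mem_cube_level_comm {n x : Fin d → ℤ} :
    x ∈ cube (level F t N n) n ↔ n ∈ cube (level F t N x) x := by
  constructor <;> intro h
  · rw [level_congr h]; exact mem_cube_comm.1 h
  · rw [level_congr h]; exact mem_cube_comm.1 h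

open Classical in
/-- The averaging matrix of the stopping cubes. -/
noncomputable def stopWeight (F : (Fin d → ℤ) → ℝ≥0∞) (t : ℝ≥0∞) (N : ℕ) (n x : Fin d → ℤ) :
    ℝ≥0 :=
  if x ∈ cube (level F t N n) n then (2 ^ (level F t N n * d))⁻¹ else 0

lemma stopWeight_comm (n x : Fin d → ℤ) : stopWeight F t N n x = stopWeight F t N x n := by
  by_cases h : x ∈ cube (level F t N n) n
  · have h' := mem_cube_level_comm.1 h
    rw [stopWeight, stopWeight, if_pos h, if_pos h', level_congr h]
  · rw [stopWeight, stopWeight, if_neg h, if_neg (mt mem_cube_level_comm.2 h)]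

lemma tsum_stopWeight_mul (G : (Fin d → ℤ) → ℝ≥0∞) (n : Fin d → ℤ) :
    ∑' x, (stopWeight F t N n x : ℝ≥0∞) * G x = cubeAvg G (level F t N n) n := by
  classical
  rw [tsum_eq_sum (s := cube (level F t N n) n), cubeAvg, Finset.mul_sum]
  · refine Finset.sum_congr rfl fun x hx => ?_
    rw [stopWeight, if_pos hx, ENNReal.coe_inv (by positivity)]
    simp
  · intro x hx
    simp [stopWeight, if_neg hx]

lemma cubeAvg_one (q : ℕ) (n : Fin d → ℤ) : cubeAvg (fun _ => 1) q n = 1 := by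
  rw [cubeAvg, Finset.sum_const, card_cube]
  simp [ENNReal.inv_mul_cancel]

lemma tsum_stopWeight (n : Fin d → ℤ) : ∑' x, (stopWeight F t N n x : ℝ≥0∞) = 1 := by
  have := tsum_stopWeight_mul (F := F) (t := t) (N := N) (fun _ => 1) n
  rwa [cubeAvg_one, funext fun x => mul_one _] at this

/-- The points at which the stopping average exceeds the threshold. -/
def IsBad (F : (Fin d → ℤ) → ℝ≥0∞) (t : ℝ≥0∞) (N : ℕ) (n : Fin d → ℤ) : Prop :=
  t < cubeAvg F (level F t N n) n

open Classical in
lemma tsum_isBad_le : t * ∑' n, (if IsBad F t N n then 1 else 0) ≤ ∑' n, F n := by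
  calc t * ∑' n, (if IsBad F t N n then 1 else 0)
      ≤ ∑' n, ∑' x, (stopWeight F t N n x : ℝ≥0∞) * F x := by
        rw [← ENNReal.tsum_mul_left]
        refine ENNReal.tsum_le_tsum fun n => ?_
        rw [tsum_stopWeight_mul]
        split_ifs with h
        · simpa using h.le
        · simp
    _ = ∑' x, F x := by
        rw [ENNReal.tsum_comm]
        refine tsum_congr fun x => ?_
        rw [ENNReal.tsum_mul_right, tsum_congr fun n => by rw [stopWeight_comm],
          tsum_stopWeight, one_mul]

/-- `n` lies in one of the cubes of side `2 ^ q` within three steps of that of `y`. -/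
def Near (q : ℕ) (n y : Fin d → ℤ) : Prop := ∀ i, |n i / 2 ^ q - y i / 2 ^ q| ≤ 3

open Classical in
lemma tsum_near (q : ℕ) (y : Fin d → ℤ) :
    ∑' n, (if Near q n y then (1 : ℝ≥0∞) else 0) ≤ 7 ^ d * 2 ^ (q * d) := by
  have hsub : ∀ n, Near q n y → n ∈ Fintype.piFinset fun i =>
      Finset.Ico ((y i / 2 ^ q - 3) * 2 ^ q) ((y i / 2 ^ q + 4) * 2 ^ q) := by
    intro n hn
    simp only [Fintype.mem_piFinset, Finset.mem_Ico]
    intro i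
    have h2 : (0 : ℤ) < 2 ^ q := by positivity
    have := abs_le.1 (hn i)
    constructor
    · exact (mul_le_mul_of_nonneg_right (by linarith) h2.le).trans (Int.ediv_mul_le (n i) h2.ne')
    · exact (Int.lt_ediv_add_one_mul_self (n i) h2).trans_le
        (mul_le_mul_of_nonneg_right (by linarith) h2.le)
  rw [tsum_eq_sum (s := Fintype.piFinset fun i =>
      Finset.Ico ((y i / 2 ^ q - 3) * 2 ^ q) ((y i / 2 ^ q + 4) * 2 ^ q))]
  · refine (Finset.sum_le_card_nsmul _ _ 1 fun n _ => by split_ifs <;> simp).trans ?_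
    rw [Fintype.card_piFinset]
    have : ∀ i, (Finset.Ico ((y i / 2 ^ q - 3) * 2 ^ q) ((y i / 2 ^ q + 4) * 2 ^ q)).card
        = 7 * 2 ^ q := fun i => by
      rw [Int.card_Ico, ← sub_mul, add_sub_sub_cancel]
      norm_num
      norm_cast
    simp [this, mul_pow, pow_mul]
  · intro n hn
    rw [if_neg (mt (hsub n) hn)]

open Classical in
lemma tsum_exceptional_le :
    ∑' n, (if ∃ y, IsBad F t N y ∧ Near (level F t N y) n y then (1 : ℝ≥0∞) else 0)
      ≤ 7 ^ d * ∑' n, (if IsBad F t N n then 1 else 0) := by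
  calc ∑' n, (if ∃ y, IsBad F t N y ∧ Near (level F t N y) n y then (1 : ℝ≥0∞) else 0)
      ≤ ∑' n, ∑' y, (2 ^ (level F t N y * d))⁻¹ * ((if IsBad F t N y then 1 else 0) *
          (if Near (level F t N y) n y then (1 : ℝ≥0∞) else 0)) := by
        refine ENNReal.tsum_le_tsum fun n => ?_
        split_ifs with h
        · obtain ⟨y, hb, hn⟩ := h
          refine (tsum_stopWeight (F := F) (t := t) (N := N) y).symm.trans_le ?_
          refine ENNReal.tsum_le_tsum fun x => ?_
          by_cases hx : x ∈ cube (level F t N y) y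
          · have hl := level_congr hx
            have h1 : IsBad F t N x := by
              rw [IsBad, hl, cubeAvg_congr F le_rfl (mem_cube.1 hx)]; exact hb
            have h2 : Near (level F t N x) n x := fun i => by
              have := congrFun (mem_cube.1 hx) i
              simp only [coarse] at this
              rw [hl, this]; exact hn i
            rw [stopWeight, if_pos hx, if_pos h1, if_pos h2, hl, ENNReal.coe_inv (by positivity)]
            simp
          · simp [stopWeight, hx]
        · simp
    _ ≤ ∑' y, 7 ^ d * (if IsBad F t N y then 1 else 0) := by
        rw [ENNReal.tsum_comm]
        refine ENNReal.tsum_le_tsum fun y => ?_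
        rw [ENNReal.tsum_mul_left, ENNReal.tsum_mul_left]
        calc (2 ^ (level F t N y * d))⁻¹ * ((if IsBad F t N y then 1 else 0) *
              ∑' n, (if Near (level F t N y) n y then (1 : ℝ≥0∞) else 0))
            ≤ (2 ^ (level F t N y * d))⁻¹ * ((if IsBad F t N y then 1 else 0) *
              (7 ^ d * 2 ^ (level F t N y * d))) := by gcongr; exact tsum_near _ _
          _ = ((2 ^ (level F t N y * d))⁻¹ * 2 ^ (level F t N y * d)) *
              (7 ^ d * (if IsBad F t N y then 1 else 0)) := by ring
          _ = _ := by rw [ENNReal.inv_mul_cancel (by simp) (by simp), one_mul]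
    _ = _ := ENNReal.tsum_mul_left

end level

/-- Convolution on `ℤ^d`. -/
noncomputable def latConv {d : ℕ} (K f : (Fin d → ℤ) → ℂ) (n : Fin d → ℤ) : ℂ :=
  ∑' m, f m * K (n - m)

/-- The maximal function of a family of convolution operators. -/
noncomputable def latMax {d : ℕ} {ι : Type*} (K : ι → (Fin d → ℤ) → ℂ) (f : (Fin d → ℤ) → ℂ)
    (n : Fin d → ℤ) : ℝ≥0∞ :=
  ⨆ k, ‖latConv (K k) f n‖ₑ

section conv
variable {d : ℕ}

lemma tsum_sub_left (G : (Fin d → ℤ) → ℝ≥0∞) (n : Fin d → ℤ) : ∑' m, G (n - m) = ∑' m, G m :=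
  (Equiv.subLeft n).tsum_eq G

lemma enorm_le_of_tsum_le {K : (Fin d → ℤ) → ℂ} {A : ℝ≥0∞} (hK : ∑' n, ‖K n‖ₑ ≤ A)
    (n : Fin d → ℤ) : ‖K n‖ₑ ≤ A :=
  (ENNReal.le_tsum n).trans hK

lemma summable_latConv {K f : (Fin d → ℤ) → ℂ} {A : ℝ≥0∞} (hA : A ≠ ∞)
    (hK : ∑' n, ‖K n‖ₑ ≤ A) (hf : ∑' n, ‖f n‖ₑ ≠ ∞) (n : Fin d → ℤ) :
    Summable fun m => f m * K (n - m) := by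
  refine Summable.of_enorm (ne_top_of_le_ne_top (ENNReal.mul_ne_top hf hA) ?_)
  rw [← ENNReal.tsum_mul_right]
  refine ENNReal.tsum_le_tsum fun m => ?_
  rw [enorm_mul]
  gcongr
  exact enorm_le_of_tsum_le hK _

lemma enorm_latConv_le {K f : (Fin d → ℤ) → ℂ} {A B : ℝ≥0∞}
    (hK : ∑' n, ‖K n‖ₑ ≤ A) (hf : ∀ n, ‖f n‖ₑ ≤ B) (n : Fin d → ℤ) :
    ‖latConv K f n‖ₑ ≤ A * B := by
  calc ‖latConv K f n‖ₑ ≤ ∑' m, ‖f m * K (n - m)‖ₑ := enorm_tsum_le_tsum_enorm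
    _ ≤ ∑' m, B * ‖K (n - m)‖ₑ := ENNReal.tsum_le_tsum fun m => by
        rw [enorm_mul]; gcongr; exact hf m
    _ = B * ∑' m, ‖K m‖ₑ := by
        rw [ENNReal.tsum_mul_left, tsum_sub_left (fun m => ‖K m‖ₑ)]
    _ ≤ A * B := by rw [mul_comm]; gcongr

lemma latMax_le {ι : Type*} {K : ι → (Fin d → ℤ) → ℂ} {f : (Fin d → ℤ) → ℂ} {A B : ℝ≥0∞}
    (hK : ∀ k, ∑' n, ‖K k n‖ₑ ≤ A) (hf : ∀ n, ‖f n‖ₑ ≤ B) (n : Fin d → ℤ) :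
    latMax K f n ≤ A * B :=
  iSup_le fun k => enorm_latConv_le (hK k) hf n

lemma latMax_add_le {ι : Type*} {K : ι → (Fin d → ℤ) → ℂ} {f g : (Fin d → ℤ) → ℂ} {A : ℝ≥0∞}
    (hA : A ≠ ∞) (hK : ∀ k, ∑' n, ‖K k n‖ₑ ≤ A) (hf : ∑' n, ‖f n‖ₑ ≠ ∞)
    (hg : ∑' n, ‖g n‖ₑ ≠ ∞) (n : Fin d → ℤ) :
    latMax K (f + g) n ≤ latMax K f n + latMax K g n := by
  refine iSup_le fun k => ?_
  have : latConv (K k) (f + g) n = latConv (K k) f n + latConv (K k) g n := by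
    rw [latConv, latConv, latConv, ← (summable_latConv hA (hK k) hf n).tsum_add
      (summable_latConv hA (hK k) hg n)]
    simp [add_mul]
  rw [this]
  exact (enorm_add_le _ _).trans (add_le_add (le_iSup (fun k => ‖latConv (K k) f n‖ₑ) k)
    (le_iSup (fun k => ‖latConv (K k) g n‖ₑ) k))

/-- The average of `f` over the stopping cubes. -/
noncomputable def stopAvg (F : (Fin d → ℤ) → ℝ≥0∞) (t : ℝ≥0∞) (N : ℕ) (f : (Fin d → ℤ) → ℂ)
    (n : Fin d → ℤ) : ℂ :=
  ∑' x, (stopWeight F t N n x : ℂ) * f x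

variable {F : (Fin d → ℤ) → ℝ≥0∞} {t : ℝ≥0∞} {N : ℕ}

lemma enorm_stopWeight (n x : Fin d → ℤ) :
    ‖((stopWeight F t N n x : ℝ) : ℂ)‖ₑ = stopWeight F t N n x := by
  rw [← ofReal_norm, Complex.norm_real, Real.norm_of_nonneg (NNReal.coe_nonneg _),
    ENNReal.ofReal_coe_nnreal]

lemma enorm_stopAvg_le (f : (Fin d → ℤ) → ℂ) (n : Fin d → ℤ) :
    ‖stopAvg F t N f n‖ₑ ≤ cubeAvg (fun x => ‖f x‖ₑ) (level F t N n) n := by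
  rw [← tsum_stopWeight_mul]
  refine enorm_tsum_le_tsum_enorm.trans (ENNReal.tsum_le_tsum fun x => ?_)
  rw [enorm_mul, enorm_stopWeight]

lemma tsum_enorm_stopAvg_le (f : (Fin d → ℤ) → ℂ) :
    ∑' n, ‖stopAvg F t N f n‖ₑ ≤ ∑' n, ‖f n‖ₑ := by
  calc ∑' n, ‖stopAvg F t N f n‖ₑ
      ≤ ∑' n, ∑' x, (stopWeight F t N n x : ℝ≥0∞) * ‖f x‖ₑ := by
        refine ENNReal.tsum_le_tsum fun n => ?_
        rw [tsum_stopWeight_mul]; exact enorm_stopAvg_le f n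
    _ = ∑' x, ‖f x‖ₑ := by
        rw [ENNReal.tsum_comm]
        refine tsum_congr fun x => ?_
        rw [ENNReal.tsum_mul_right, tsum_congr fun n => by rw [stopWeight_comm],
          tsum_stopWeight, one_mul]

lemma tsum_stopWeight_complex (n : Fin d → ℤ) :
    ∑' x, ((stopWeight F t N n x : ℝ) : ℂ) = 1 := by
  have h := tsum_stopWeight (F := F) (t := t) (N := N) n
  have hs : Summable (stopWeight F t N n) :=
    ENNReal.tsum_coe_ne_top_iff_summable.1 (h ▸ ENNReal.one_ne_top)
  rw [← ENNReal.coe_tsum hs, ENNReal.coe_eq_one] at h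
  rw [← Complex.ofReal_tsum, ← NNReal.coe_tsum, h]
  simp

lemma summable_stopWeight_complex (n : Fin d → ℤ) :
    Summable fun x => ((stopWeight F t N n x : ℝ) : ℂ) := by
  refine Summable.of_enorm ?_
  simp_rw [enorm_stopWeight]
  rw [tsum_stopWeight]; simp

lemma enorm_latConv_sub_le {K f : (Fin d → ℤ) → ℂ} {A : ℝ≥0∞} (hA : A ≠ ∞)
    (hK : ∑' n, ‖K n‖ₑ ≤ A) (hf : ∑' n, ‖f n‖ₑ ≠ ∞) (n : Fin d → ℤ) :
    ‖latConv K (f - stopAvg F t N f) n‖ₑ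
      ≤ ∑' y, ‖f y‖ₑ * ∑' x, (stopWeight F t N y x : ℝ≥0∞) * ‖K (n - y) - K (n - x)‖ₑ := by
  have hg : ∑' n, ‖stopAvg F t N f n‖ₑ ≠ ∞ := ne_top_of_le_ne_top hf (tsum_enorm_stopAvg_le f)
  have hsum : Summable (Function.uncurry fun x y : Fin d → ℤ =>
      ((stopWeight F t N x y : ℝ) : ℂ) * f y * K (n - x)) := by
    refine Summable.of_enorm (ne_top_of_le_ne_top (ENNReal.mul_ne_top hf hA) ?_)
    rw [ENNReal.tsum_prod', ENNReal.tsum_comm, ← ENNReal.tsum_mul_right]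
    refine ENNReal.tsum_le_tsum fun y => ?_
    calc ∑' x, ‖((stopWeight F t N x y : ℝ) : ℂ) * f y * K (n - x)‖ₑ
        ≤ ∑' x, (stopWeight F t N y x : ℝ≥0∞) * (‖f y‖ₑ * A) := by
          refine ENNReal.tsum_le_tsum fun x => ?_
          rw [enorm_mul, enorm_mul, enorm_stopWeight, stopWeight_comm, mul_assoc]
          gcongr
          exact enorm_le_of_tsum_le hK _
      _ = ‖f y‖ₑ * A := by rw [ENNReal.tsum_mul_right, tsum_stopWeight, one_mul]
  have hKs : ∀ y, Summable fun x => ((stopWeight F t N y x : ℝ) : ℂ) * K (n - x) := fun y => by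
    refine Summable.of_enorm (ne_top_of_le_ne_top hA ?_)
    calc ∑' x, ‖((stopWeight F t N y x : ℝ) : ℂ) * K (n - x)‖ₑ
        ≤ ∑' x, (stopWeight F t N y x : ℝ≥0∞) * A := by
          refine ENNReal.tsum_le_tsum fun x => ?_
          rw [enorm_mul, enorm_stopWeight]
          gcongr
          exact enorm_le_of_tsum_le hK _
      _ = A := by rw [ENNReal.tsum_mul_right, tsum_stopWeight, one_mul]
  have h1 : latConv K (stopAvg F t N f) n
      = ∑' y, f y * ∑' x, ((stopWeight F t N y x : ℝ) : ℂ) * K (n - x) := by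
    calc latConv K (stopAvg F t N f) n
        = ∑' x, ∑' y, ((stopWeight F t N x y : ℝ) : ℂ) * f y * K (n - x) :=
          tsum_congr fun x => by rw [tsum_mul_right]; rfl
      _ = ∑' y, ∑' x, ((stopWeight F t N x y : ℝ) : ℂ) * f y * K (n - x) :=
          (hsum.tsum_comm).symm
      _ = _ := tsum_congr fun y => by
          rw [← tsum_mul_left]
          exact tsum_congr fun x => by rw [stopWeight_comm]; ring
  have h2 : ∀ y, K (n - y) - ∑' x, ((stopWeight F t N y x : ℝ) : ℂ) * K (n - x)
      = ∑' x, ((stopWeight F t N y x : ℝ) : ℂ) * (K (n - y) - K (n - x)) := fun y => by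
    have : K (n - y) = ∑' x, ((stopWeight F t N y x : ℝ) : ℂ) * K (n - y) := by
      rw [tsum_mul_right, tsum_stopWeight_complex, one_mul]
    conv_lhs => rw [this]
    rw [← ((summable_stopWeight_complex y).mul_right _).tsum_sub (hKs y)]
    simp only [mul_sub]
  have hfs := summable_latConv hA hK hf n
  have hgs : Summable fun y => f y * ∑' x, ((stopWeight F t N y x : ℝ) : ℂ) * K (n - x) := by
    have := hsum.prod_symm.prod
    refine this.congr fun y => ?_
    rw [← tsum_mul_left]
    exact tsum_congr fun x => by
      simp only [Prod.swap_prod_mk, Function.uncurry_apply_pair]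
      rw [stopWeight_comm]; ring
  have h3 : latConv K (f - stopAvg F t N f) n
      = ∑' y, f y * ∑' x, ((stopWeight F t N y x : ℝ) : ℂ) * (K (n - y) - K (n - x)) := by
    calc latConv K (f - stopAvg F t N f) n
        = latConv K f n - latConv K (stopAvg F t N f) n := by
          rw [latConv, latConv, latConv, ← hfs.tsum_sub (summable_latConv hA hK hg n)]
          simp [sub_mul]
      _ = _ := by
          rw [h1, latConv, ← hfs.tsum_sub hgs]
          exact tsum_congr fun y => by rw [← mul_sub, h2]
  rw [h3]
  refine enorm_tsum_le_tsum_enorm.trans (ENNReal.tsum_le_tsum fun y => ?_)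
  rw [enorm_mul]
  gcongr
  refine enorm_tsum_le_tsum_enorm.trans (ENNReal.tsum_le_tsum fun x => ?_)
  rw [enorm_mul, enorm_stopWeight]

end conv

open Classical in
/-- Hörmander's condition for a family of kernels, with the supremum inside the sum. -/
def MaxHormander {d : ℕ} {ι : Type*} (K : ι → (Fin d → ℤ) → ℂ) (B : ℝ≥0∞) : Prop :=
  ∀ (q : ℕ) (y x : Fin d → ℤ), coarse q x = coarse q y →
    ∑' n, (if Near q n y then 0 else ⨆ k, ‖K k (n - y) - K k (n - x)‖ₑ) ≤ B

lemma exists_cubeAvg_le {d : ℕ} (hd : 1 ≤ d) {F : (Fin d → ℤ) → ℝ≥0∞} (hF : ∑' n, F n ≠ ∞)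
    {t : ℝ≥0∞} (ht : t ≠ 0) : ∃ N, ∀ q, N < q → ∀ n, cubeAvg F q n ≤ t := by
  obtain ⟨N, hN⟩ := ENNReal.exists_nat_gt (ENNReal.div_ne_top hF ht)
  refine ⟨N, fun q hq n => ?_⟩
  have h1 : ∑' n, F n ≤ 2 ^ (q * d) * t := by
    have h0 : (N : ℝ≥0∞) ≤ 2 ^ (q * d) := by
      have : N ≤ 2 ^ (q * d) :=
        (hq.le.trans (Nat.le_mul_of_pos_right q hd)).trans Nat.lt_two_pow_self.le
      exact_mod_cast this
    exact (ENNReal.div_le_iff_le_mul (Or.inl ht) (Or.inr (by positivity))).1 (hN.le.trans h0)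
  calc cubeAvg F q n ≤ (2 ^ (q * d))⁻¹ * (2 ^ (q * d) * t) := by
        rw [cubeAvg]; gcongr; exact (ENNReal.sum_le_tsum _).trans h1
    _ = t := by rw [← mul_assoc, ENNReal.inv_mul_cancel (by simp) (by simp), one_mul]

open Classical in
/-- The weak type `(1,1)` estimate. -/
theorem latMax_weak_type {d : ℕ} (hd : 1 ≤ d) {ι : Type*} {K : ι → (Fin d → ℤ) → ℂ} {A B : ℝ≥0∞}
    (hA : A ≠ ∞) (hK : ∀ k, ∑' n, ‖K k n‖ₑ ≤ A) (hB : MaxHormander K B)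
    {f : (Fin d → ℤ) → ℂ} (hf : ∑' n, ‖f n‖ₑ ≠ ∞) {t : ℝ≥0∞} (ht : t ≠ 0) :
    t * ∑' n, (if (A * 2 ^ d + 1) * t < latMax K f n then 1 else 0)
      ≤ (7 ^ d + B) * ∑' n, ‖f n‖ₑ := by
  set F : (Fin d → ℤ) → ℝ≥0∞ := fun n => ‖f n‖ₑ with hFdef
  obtain ⟨N, hN⟩ := exists_cubeAvg_le hd hf ht
  set E : (Fin d → ℤ) → Prop := fun n => ∃ y, IsBad F t N y ∧ Near (level F t N y) n y with hE
  have hg : ∑' n, ‖stopAvg F t N f n‖ₑ ≠ ∞ := ne_top_of_le_ne_top hf (tsum_enorm_stopAvg_le f)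
  have hb : ∑' n, ‖(f - stopAvg F t N f) n‖ₑ ≠ ∞ := by
    refine ne_top_of_le_ne_top (ENNReal.add_ne_top.2 ⟨hf, hg⟩) ?_
    rw [← ENNReal.tsum_add]
    exact ENNReal.tsum_le_tsum fun n => enorm_sub_le
  have hgood : ∀ n, latMax K (stopAvg F t N f) n ≤ A * (2 ^ d * t) :=
    latMax_le hK fun n => (enorm_stopAvg_le f n).trans (cubeAvg_level_le hN n)
  have hsplit : ∀ n, latMax K f n ≤ A * (2 ^ d * t) + latMax K (f - stopAvg F t N f) n := by
    intro n
    have := latMax_add_le hA hK hg hb n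
    rw [add_sub_cancel] at this
    exact this.trans (by gcongr; exact hgood n)
  have hpt : ∀ n, t * (if (A * 2 ^ d + 1) * t < latMax K f n then 1 else 0)
      ≤ t * (if E n then 1 else 0) + if E n then 0 else latMax K (f - stopAvg F t N f) n := by
    intro n
    by_cases hn : E n
    · simp only [hn, if_true, add_zero]; gcongr; split_ifs <;> simp
    · simp only [hn, if_false, mul_zero, zero_add]
      split_ifs with h
      · rw [mul_one]
        by_contra hc
        rw [not_le] at hc
        refine absurd (h.trans_le (hsplit n)) (not_lt.2 ?_)
        rw [add_mul, one_mul, mul_assoc]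
        gcongr
      · simp
  have hbad : ∑' n, (if E n then 0 else latMax K (f - stopAvg F t N f) n) ≤ B * ∑' n, F n := by
    calc ∑' n, (if E n then 0 else latMax K (f - stopAvg F t N f) n)
        ≤ ∑' n, ∑' y, ∑' x, F y * ((stopWeight F t N y x : ℝ≥0∞) *
            (if E n then 0 else ⨆ k, ‖K k (n - y) - K k (n - x)‖ₑ)) := by
          refine ENNReal.tsum_le_tsum fun n => ?_
          by_cases hn : E n
          · simp [hn]
          · simp only [hn, if_false]
            refine iSup_le fun k => (enorm_latConv_sub_le hA (hK k) hf n).trans ?_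
            refine ENNReal.tsum_le_tsum fun y => ?_
            rw [← ENNReal.tsum_mul_left]
            refine ENNReal.tsum_le_tsum fun x => ?_
            gcongr
            exact le_iSup (fun k => ‖K k (n - y) - K k (n - x)‖ₑ) k
      _ = ∑' y, ∑' x, ∑' n, F y * ((stopWeight F t N y x : ℝ≥0∞) *
            (if E n then 0 else ⨆ k, ‖K k (n - y) - K k (n - x)‖ₑ)) := by
          rw [ENNReal.tsum_comm]
          exact tsum_congr fun y => ENNReal.tsum_comm
      _ ≤ ∑' y, ∑' x, F y * ((stopWeight F t N y x : ℝ≥0∞) * B) := by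
          refine ENNReal.tsum_le_tsum fun y => ENNReal.tsum_le_tsum fun x => ?_
          rw [ENNReal.tsum_mul_left, ENNReal.tsum_mul_left]
          by_cases hx : x ∈ cube (level F t N y) y
          · gcongr
            by_cases hy : IsBad F t N y
            · refine le_trans (ENNReal.tsum_le_tsum fun n => ?_)
                (hB (level F t N y) y x (mem_cube.1 hx))
              by_cases hnn : Near (level F t N y) n y
              · simp [show E n from ⟨y, hy, hnn⟩]
              · simp only [hnn, if_false]; split_ifs <;> simp
            · have h0 := (level_eq_zero_or (F := F) (t := t) (N := N) y).resolve_right hy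
              rw [h0, cube_zero, Finset.mem_singleton] at hx
              simp [hx]
          · simp [stopWeight, hx]
      _ = B * ∑' n, F n := by
          rw [← ENNReal.tsum_mul_left]
          refine tsum_congr fun y => ?_
          rw [ENNReal.tsum_mul_left, ENNReal.tsum_mul_right, tsum_stopWeight, one_mul, mul_comm]
  calc t * ∑' n, (if (A * 2 ^ d + 1) * t < latMax K f n then 1 else 0)
      = ∑' n, t * (if (A * 2 ^ d + 1) * t < latMax K f n then 1 else 0) :=
        ENNReal.tsum_mul_left.symm
    _ ≤ t * ∑' n, (if E n then 1 else 0)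
        + ∑' n, if E n then 0 else latMax K (f - stopAvg F t N f) n := by
        rw [← ENNReal.tsum_mul_left, ← ENNReal.tsum_add]
        exact ENNReal.tsum_le_tsum hpt
    _ ≤ t * (7 ^ d * ∑' n, (if IsBad F t N n then 1 else 0)) + B * ∑' n, F n := by
        gcongr
        exact tsum_exceptional_le
    _ = 7 ^ d * (t * ∑' n, (if IsBad F t N n then 1 else 0)) + B * ∑' n, F n := by ring
    _ ≤ 7 ^ d * ∑' n, F n + B * ∑' n, F n := by gcongr; exact tsum_isBad_le
    _ = _ := by ring

section interpolation
variable {d : ℕ} {ι : Type*} {K : ι → (Fin d → ℤ) → ℂ} {A B : ℝ≥0∞}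

open Classical in
/-- The level sets of the maximal function are controlled by the large values of `f`. -/
lemma latMax_level_set_le (hd : 1 ≤ d) (hA : A ≠ ∞) (hK : ∀ k, ∑' n, ‖K k n‖ₑ ≤ A)
    (hB : MaxHormander K B) {f : (Fin d → ℤ) → ℂ} (hf : ∑' n, ‖f n‖ₑ ≠ ∞) {t : ℝ} (ht : 0 < t) :
    ENNReal.ofReal t * ∑' n, (if (A * 2 ^ d + 1 + A) * ENNReal.ofReal t < latMax K f n
      then 1 else 0) ≤ (7 ^ d + B) * ∑' n, if t < ‖f n‖ then ‖f n‖ₑ else 0 := by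
  set f₁ : (Fin d → ℤ) → ℂ := fun n => if t < ‖f n‖ then f n else 0 with hf₁
  set f₂ : (Fin d → ℤ) → ℂ := fun n => if t < ‖f n‖ then 0 else f n with hf₂
  have hadd : f = f₁ + f₂ := by
    funext n; simp only [hf₁, hf₂, Pi.add_apply]; split_ifs <;> simp
  have h₁ : ∑' n, ‖f₁ n‖ₑ ≠ ∞ := ne_top_of_le_ne_top hf <| ENNReal.tsum_le_tsum fun n => by
    simp only [hf₁]; split_ifs <;> simp
  have h₂ : ∑' n, ‖f₂ n‖ₑ ≠ ∞ := ne_top_of_le_ne_top hf <| ENNReal.tsum_le_tsum fun n => by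
    simp only [hf₂]; split_ifs <;> simp
  have hsmall : ∀ n, ‖f₂ n‖ₑ ≤ ENNReal.ofReal t := fun n => by
    simp only [hf₂]
    split_ifs with h
    · simp
    · rw [← ofReal_norm]; exact ENNReal.ofReal_le_ofReal (not_lt.1 h)
  have hw := latMax_weak_type hd hA hK hB h₁ (t := ENNReal.ofReal t) (by simpa using ht)
  have he : ∀ n, ‖f₁ n‖ₑ = if t < ‖f n‖ then ‖f n‖ₑ else 0 := fun n => by
    simp only [hf₁]; split_ifs <;> simp
  simp_rw [he] at hw
  refine le_trans ?_ hw
  gcongr with n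
  by_cases h : (A * 2 ^ d + 1 + A) * ENNReal.ofReal t < latMax K f n
  · rw [if_pos h, if_pos]
    by_contra hc
    rw [not_lt] at hc
    refine absurd h (not_lt.2 ?_)
    calc latMax K f n ≤ latMax K f₁ n + latMax K f₂ n := by
          conv_lhs => rw [hadd]
          exact latMax_add_le hA hK h₁ h₂ n
      _ ≤ (A * 2 ^ d + 1) * ENNReal.ofReal t + A * ENNReal.ofReal t :=
          add_le_add hc (latMax_le hK hsmall n)
      _ = _ := by ring
  · rw [if_neg h]; exact zero_le

/-- The strong type `(p,p)` estimate for `1 < p < ∞`. -/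
theorem tsum_latMax_rpow_le (hd : 1 ≤ d) (hA : A ≠ ∞) (hK : ∀ k, ∑' n, ‖K k n‖ₑ ≤ A)
    (hBtop : B ≠ ∞) (hB : MaxHormander K B) {p : ℝ} (hp : 1 < p)
    {f : (Fin d → ℤ) → ℂ} (hf : ∑' n, ‖f n‖ₑ ≠ ∞) :
    ∑' n, latMax K f n ^ p ≤ (A * 2 ^ d + 1 + A) ^ p * (ENNReal.ofReal p *
      ((7 ^ d + B) * ((ENNReal.ofReal (p - 1))⁻¹ * ∑' n, ‖f n‖ₑ ^ p))) := by
  classical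
  set c : ℝ≥0∞ := A * 2 ^ d + 1 + A with hc
  have hctop : c ≠ ∞ := ENNReal.add_ne_top.2
    ⟨ENNReal.add_ne_top.2 ⟨ENNReal.mul_ne_top hA (by simp), by simp⟩, hA⟩
  have hc0 : c ≠ 0 := by simp [hc]
  have hfin : ∀ n, latMax K f n ≠ ∞ := fun n =>
    ne_top_of_le_ne_top (ENNReal.mul_ne_top hA hf)
      (latMax_le hK (fun n => ENNReal.le_tsum n) n)
  set τ : (Fin d → ℤ) → ℝ := fun n => (latMax K f n / c).toReal with hτ
  have hτof : ∀ n, ENNReal.ofReal (τ n) = latMax K f n / c := fun n =>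
    ENNReal.ofReal_toReal (ENNReal.div_ne_top (hfin n) hc0)
  have hlt : ∀ (t : ℝ) n, 0 < t → t < τ n → c * ENNReal.ofReal t < latMax K f n :=
    fun t n h0 h => by
      rw [mul_comm, ← ENNReal.lt_div_iff_mul_lt (Or.inl hc0) (Or.inl hctop), ← hτof]
      exact (ENNReal.ofReal_lt_ofReal_iff (h0.trans h)).2 h
  set μ : Measure (Fin d → ℤ) := Measure.count.withDensity fun n => ‖f n‖ₑ with hμ
  have hcount : ∀ s : Set (Fin d → ℤ), Measure.count s = ∑' n, if n ∈ s then (1 : ℝ≥0∞) else 0 :=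
    fun s => by
      rw [← lintegral_indicator_one (Set.to_countable s).measurableSet, lintegral_count]
      simp [Set.indicator_apply]
  have hmu : ∀ s : Set (Fin d → ℤ), μ s = ∑' n, if n ∈ s then ‖f n‖ₑ else 0 := fun s => by
    rw [hμ, withDensity_apply _ (Set.to_countable s).measurableSet,
      ← lintegral_indicator (Set.to_countable s).measurableSet, lintegral_count]
    simp [Set.indicator_apply]
  have hmeas : ∀ t ∈ Set.Ioi (0 : ℝ),
      Measure.count {n | t < τ n} * ENNReal.ofReal (t ^ (p - 1))
        ≤ (7 ^ d + B) * (μ {n | t < ‖f n‖} * ENNReal.ofReal (t ^ (p - 1 - 1))) := by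
    intro t ht
    have ht0 : (0 : ℝ) < t := ht
    rw [show t ^ (p - 1) = t * t ^ (p - 1 - 1) by
      rw [Real.rpow_sub_one ht0.ne' (p - 1)]; field_simp, ENNReal.ofReal_mul ht0.le, ← mul_assoc,
      ← mul_assoc]
    refine mul_le_mul' ?_ le_rfl
    rw [mul_comm, hcount, hmu]
    refine le_trans ?_ (latMax_level_set_le hd hA hK hB hf ht0)
    gcongr with n
    by_cases h : t < τ n
    · simp [h, hlt t n ht0 h, ← hc]
    · simp [h]
  have hmain : ∑' n, ENNReal.ofReal (τ n ^ p) ≤ ENNReal.ofReal p *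
      ((7 ^ d + B) * ((ENNReal.ofReal (p - 1))⁻¹ * ∑' n, ‖f n‖ₑ ^ p)) := by
    have hp1 : 0 < p - 1 := by linarith
    rw [← lintegral_count (fun n => ENNReal.ofReal (τ n ^ p)),
      lintegral_rpow_eq_lintegral_meas_lt_mul _ (Filter.Eventually.of_forall fun n =>
        ENNReal.toReal_nonneg) (measurable_of_countable τ).aemeasurable (by linarith)]
    gcongr
    have h2 := lintegral_rpow_eq_lintegral_meas_lt_mul μ (f := fun n => ‖f n‖)
      (Filter.Eventually.of_forall fun n => norm_nonneg _)
      (measurable_of_countable _).aemeasurable hp1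
    have h3 : ∫⁻ n, ENNReal.ofReal (‖f n‖ ^ (p - 1)) ∂μ = ∑' n, ‖f n‖ₑ ^ p := by
      rw [hμ, lintegral_withDensity_eq_lintegral_mul _ (measurable_of_countable _)
        (measurable_of_countable _), lintegral_count]
      refine tsum_congr fun n => ?_
      rw [Pi.mul_apply, ← ENNReal.ofReal_rpow_of_nonneg (norm_nonneg _) hp1.le, ofReal_norm]
      conv_rhs => rw [show p = 1 + (p - 1) by ring,
        ENNReal.rpow_add_of_nonneg _ _ zero_le_one hp1.le, ENNReal.rpow_one]
    calc ∫⁻ t in Set.Ioi 0, Measure.count {n | t < τ n} * ENNReal.ofReal (t ^ (p - 1))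
        ≤ ∫⁻ t in Set.Ioi 0,
          (7 ^ d + B) * (μ {n | t < ‖f n‖} * ENNReal.ofReal (t ^ (p - 1 - 1))) :=
          setLIntegral_mono' measurableSet_Ioi hmeas
      _ = (7 ^ d + B) * ∫⁻ t in Set.Ioi 0, μ {n | t < ‖f n‖} * ENNReal.ofReal (t ^ (p - 1 - 1)) :=
          lintegral_const_mul' _ _ (by simp [hBtop])
      _ = _ := by
          congr 1
          rw [← h3, h2, ← mul_assoc, ENNReal.inv_mul_cancel (by simpa using hp1) (by simp), one_mul]
  calc ∑' n, latMax K f n ^ p = ∑' n, c ^ p * ENNReal.ofReal (τ n ^ p) := by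
        refine tsum_congr fun n => ?_
        rw [← ENNReal.ofReal_rpow_of_nonneg ENNReal.toReal_nonneg (by linarith), hτof,
          ← ENNReal.mul_rpow_of_nonneg _ _ (by linarith), ENNReal.mul_div_cancel hc0 hctop]
    _ ≤ _ := by rw [ENNReal.tsum_mul_left]; gcongr

/-- Boundedness of the maximal function on `ℓ^p`, `1 < p < ∞`. -/
theorem exists_latMax_bound (hd : 1 ≤ d) (hA : A ≠ ∞) (hK : ∀ k, ∑' n, ‖K k n‖ₑ ≤ A)
    (hBtop : B ≠ ∞) (hB : MaxHormander K B) {p : ℝ} (hp : 1 < p) :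
    ∃ C : ℝ, 0 < C ∧ ∀ f : (Fin d → ℤ) → ℂ, ∑' n, ‖f n‖ₑ ≠ ∞ →
      (∑' n, latMax K f n ^ p) ^ (1 / p) ≤ ENNReal.ofReal C * (∑' n, ‖f n‖ₑ ^ p) ^ (1 / p) := by
  have hp0 : 0 < p := by linarith
  set D : ℝ≥0∞ := (A * 2 ^ d + 1 + A) ^ p * (ENNReal.ofReal p *
      ((7 ^ d + B) * (ENNReal.ofReal (p - 1))⁻¹)) with hD
  have hDtop : D ≠ ∞ := by
    refine ENNReal.mul_ne_top (ENNReal.rpow_ne_top_of_nonneg hp0.le ?_) (ENNReal.mul_ne_top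
      (by simp) (ENNReal.mul_ne_top (by simp [hBtop]) (by simpa using hp)))
    exact ENNReal.add_ne_top.2
      ⟨ENNReal.add_ne_top.2 ⟨ENNReal.mul_ne_top hA (by simp), by simp⟩, hA⟩
  have hDp : D ^ (1 / p) ≠ ∞ := ENNReal.rpow_ne_top_of_nonneg (by positivity) hDtop
  refine ⟨(D ^ (1 / p)).toReal + 1, by positivity, fun f hf => ?_⟩
  have h := tsum_latMax_rpow_le hd hA hK hBtop hB hp hf
  rw [← mul_assoc, ← mul_assoc, ← mul_assoc] at h
  calc (∑' n, latMax K f n ^ p) ^ (1 / p) ≤ (D * ∑' n, ‖f n‖ₑ ^ p) ^ (1 / p) := by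
        gcongr
        refine h.trans_eq ?_
        rw [hD]; ring
    _ = D ^ (1 / p) * (∑' n, ‖f n‖ₑ ^ p) ^ (1 / p) :=
        ENNReal.mul_rpow_of_nonneg _ _ (by positivity)
    _ ≤ _ := by
        gcongr
        rw [ENNReal.le_ofReal_iff_toReal_le hDp (by positivity)]
        linarith

end interpolation

section calculus
variable {E : Type*} [NormedAddCommGroup E] [NormedSpace ℝ E]

lemma iteratedDeriv_comp_mul_left (n : ℕ) (f : ℝ → E) (c x : ℝ) :
    iteratedDeriv n (fun v => f (c * v)) x = c ^ n • iteratedDeriv n f (c * x) := by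
  induction n generalizing x with
  | zero => simp
  | succ n ih =>
    rw [iteratedDeriv_succ, iteratedDeriv_succ, funext ih]
    change deriv (c ^ n • fun v => iteratedDeriv n f (c * v)) x = _
    rw [deriv_const_smul_field, deriv_comp_mul_left, smul_smul, pow_succ]

lemma norm_iteratedDeriv_comp_le {g : ℝ → E} {f : ℝ → ℝ} {U V : Set ℝ} (hU : IsOpen U)
    (hV : IsOpen V) {n : ℕ} (hg : ContDiffOn ℝ n g V) (hf : ContDiffOn ℝ n f U)
    (hUV : Set.MapsTo f U V) {x : ℝ} (hx : x ∈ U) {C D : ℝ}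
    (hC : ∀ i ≤ n, ‖iteratedDeriv i g (f x)‖ ≤ C)
    (hD : ∀ i, 1 ≤ i → i ≤ n → ‖iteratedDeriv i f x‖ ≤ D ^ i) :
    ‖iteratedDeriv n (g ∘ f) x‖ ≤ n.factorial * C * D ^ n := by
  have h := norm_iteratedFDerivWithin_comp_le (C := C) (D := D) hg hf le_rfl hV.uniqueDiffOn
    hU.uniqueDiffOn hUV hx (fun i hi => ?_) (fun i hi hi' => ?_)
  · rwa [norm_iteratedFDerivWithin_eq_norm_iteratedDerivWithin,
      iteratedDerivWithin_of_isOpen hU hx] at h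
  · rw [norm_iteratedFDerivWithin_eq_norm_iteratedDerivWithin,
      iteratedDerivWithin_of_isOpen hV (hUV hx)]
    exact hC i hi
  · rw [norm_iteratedFDerivWithin_eq_norm_iteratedDerivWithin,
      iteratedDerivWithin_of_isOpen hU hx]
    exact hD i hi hi'

/-- Uniform bounds for the scale invariant derivatives of a compactly supported function which is
smooth up to the origin. -/
lemma exists_norm_pow_smul_iteratedDeriv_le {φ : ℝ → E} {s m : ℕ} (hsm : s ≤ m)
    (hφ : ContDiffOn ℝ m φ (Set.Ici 0)) (hφc : HasCompactSupport φ) :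
    ∃ C : ℝ, 0 ≤ C ∧ ∀ i, 1 ≤ i → i ≤ s → ∀ a, 0 < a → a ^ i * ‖iteratedDeriv i φ a‖ ≤ C * a := by
  obtain ⟨A, hA⟩ := hφc.isCompact.isBounded.subset_closedBall 0
  have key : ∀ i, 1 ≤ i → ∃ C : ℝ, 0 ≤ C ∧ (i ≤ s → ∀ a, 0 < a →
      a ^ i * ‖iteratedDeriv i φ a‖ ≤ C * a) := by
    intro i hi
    by_cases his : i ≤ s
    swap
    · exact ⟨0, le_rfl, fun h => absurd h his⟩
    have hcont : ContinuousOn (iteratedDerivWithin i φ (Set.Ici 0)) (Set.Icc 0 A) :=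
      (hφ.continuousOn_iteratedDerivWithin (by exact_mod_cast his.trans hsm)
        (uniqueDiffOn_Ici 0)).mono Set.Icc_subset_Ici_self
    obtain ⟨C, hC⟩ := isCompact_Icc.exists_bound_of_continuousOn hcont
    refine ⟨|A| ^ (i - 1) * |C|, by positivity, fun _ a ha => ?_⟩
    by_cases haA : a ≤ A
    · have h1 := hC a ⟨ha.le, haA⟩
      have h2 : iteratedDerivWithin i φ (Set.Ici 0) a = iteratedDeriv i φ a :=
        iteratedDerivWithin_eq_iteratedDeriv (uniqueDiffOn_Ici 0)
          ((hφ.contDiffAt (Ici_mem_nhds ha)).of_le (by exact_mod_cast his.trans hsm)) ha.le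
      rw [h2] at h1
      obtain ⟨j, rfl⟩ : ∃ j, i = j + 1 := ⟨i - 1, by omega⟩
      calc a ^ (j + 1) * ‖iteratedDeriv (j + 1) φ a‖ = a ^ j * ‖iteratedDeriv (j + 1) φ a‖ * a := by
            ring
        _ ≤ |A| ^ j * |C| * a := by
            gcongr
            · exact haA.trans (le_abs_self _)
            · exact h1.trans (le_abs_self _)
        _ = _ := by simp
    · have : iteratedFDeriv ℝ i φ a = 0 := by
        by_contra h
        have := hA (support_iteratedFDeriv_subset i h)
        rw [mem_closedBall_zero_iff, Real.norm_eq_abs] at this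
        exact haA ((le_abs_self a).trans this)
      rw [← norm_iteratedFDeriv_eq_norm_iteratedDeriv, this]
      simp only [norm_zero, mul_zero]
      positivity
  choose! C hC0 hC using key
  refine ⟨∑ i ∈ Finset.Icc 1 s, C i, Finset.sum_nonneg fun i hi => hC0 i (Finset.mem_Icc.1 hi).1,
    fun i hi his a ha => (hC i hi his a ha).trans ?_⟩
  gcongr
  exact Finset.single_le_sum (f := C) (fun i hi => hC0 i (Finset.mem_Icc.1 hi).1)
    (Finset.mem_Icc.2 ⟨hi, his⟩)

lemma four_mul_sin_sq (t : ℝ) : 4 * sin (π * t) ^ 2 = 2 + (-2) * cos (2 * π * t) := by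
  rw [show 2 * π * t = 2 * (π * t) by ring, cos_two_mul, cos_sq']
  ring

lemma abs_iteratedDeriv_sin_sq_le (c t : ℝ) {i : ℕ} (hi : 1 ≤ i) :
    |iteratedDeriv i (fun t => c + 4 * sin (π * t) ^ 2) t| ≤ 2 * (2 * π) ^ i := by
  simp_rw [four_mul_sin_sq, ← add_assoc]
  rw [iteratedDeriv_const_add (by omega), iteratedDeriv_const_mul_field,
    iteratedDeriv_comp_mul_left, smul_eq_mul, abs_mul, abs_mul, abs_of_nonneg (by positivity :
      (0 : ℝ) ≤ (2 * π) ^ i)]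
  have := abs_iteratedDeriv_cos_le_one i (2 * π * t)
  rw [show |(-2 : ℝ)| = 2 by norm_num]
  have h2 : 0 < (2 * π) ^ i := by positivity
  nlinarith

lemma abs_deriv_sin_sq_le {c : ℝ} (hc : 0 ≤ c) (t : ℝ) :
    |deriv (fun t => c + 4 * sin (π * t) ^ 2) t| ≤ 4 * π * √(c + 4 * sin (π * t) ^ 2) := by
  have h : HasDerivAt (fun t => c + 4 * sin (π * t) ^ 2)
      (4 * (2 * sin (π * t) * (cos (π * t) * π))) t := by
    have h1 : HasDerivAt (fun t => π * t) π t := by simpa using (hasDerivAt_id t).const_mul π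
    have := ((h1.sin.pow 2).const_mul 4).const_add c
    simpa using this
  rw [h.deriv]
  have h2 : 2 * |sin (π * t)| ≤ √(c + 4 * sin (π * t) ^ 2) := by
    refine Real.le_sqrt_of_sq_le ?_
    rw [mul_pow, sq_abs]; linarith
  have h3 := abs_cos_le_one (π * t)
  simp only [abs_mul, abs_of_pos pi_pos, Nat.abs_ofNat]
  calc 4 * (2 * |sin (π * t)| * (|cos (π * t)| * π))
      = 4 * π * (2 * |sin (π * t)| * |cos (π * t)|) := by ring
    _ ≤ 4 * π * (√(c + 4 * sin (π * t) ^ 2) * 1) := by gcongr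
    _ = _ := by ring

/-- Derivative bounds for the dilates of a smooth function along a coordinate direction. -/
lemma exists_norm_iteratedDeriv_comp_sqrt_le {φ : ℝ → E} {s m : ℕ} (hs : 1 ≤ s) (hsm : s ≤ m)
    (hφ : ContDiffOn ℝ m φ (Set.Ici 0)) (hφc : HasCompactSupport φ) {Λ : ℝ} (hΛ : 0 ≤ Λ) :
    ∃ C : ℝ, 0 ≤ C ∧ ∀ κ, 0 < κ → ∀ c, 0 ≤ c → c ≤ Λ → ∀ t, 0 < c + 4 * sin (π * t) ^ 2 →
      ContDiffAt ℝ s (fun t => φ (κ * √(c + 4 * sin (π * t) ^ 2))) t ∧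
      ‖iteratedDeriv s (fun t => φ (κ * √(c + 4 * sin (π * t) ^ 2))) t‖
        ≤ C * κ / √(c + 4 * sin (π * t) ^ 2) ^ (s - 1) := by
  obtain ⟨Cφ, hCφ0, hCφ⟩ := exists_norm_pow_smul_iteratedDeriv_le hsm hφ hφc
  set Q : ℝ := ∑ i ∈ Finset.range (s + 1), |iteratedDeriv i (fun x => √x) 1| with hQ
  have hQ0 : 0 ≤ Q := Finset.sum_nonneg fun _ _ => abs_nonneg _
  have hQi : ∀ i ≤ s, |iteratedDeriv i (fun x => √x) 1| ≤ Q := fun i hi =>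
    Finset.single_le_sum (f := fun i => |iteratedDeriv i (fun x => √x) 1|)
      (fun _ _ => abs_nonneg _) (Finset.mem_range.2 (by omega))
  set D₁ : ℝ := 4 * π * (Λ + 4) with hD₁
  set D₂ : ℝ := s.factorial * (Q + 1) * D₁ with hD₂
  have hD₁0 : 0 < D₁ := by positivity
  refine ⟨s.factorial * Cφ * D₂ ^ s, by positivity, fun κ hκ c hc hcΛ t ht => ?_⟩
  set u : ℝ → ℝ := fun t => c + 4 * sin (π * t) ^ 2 with hu
  have hucont : Continuous u := by fun_prop
  have husmooth : ContDiff ℝ s u := by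
    simp only [hu]
    exact contDiff_const.add (contDiff_const.mul
      ((contDiff_sin.comp (contDiff_const.mul contDiff_id)).pow 2))
  change 0 < u t at ht
  set S₀ : ℝ := √(u t) with hS₀
  have hS0 : 0 < S₀ := Real.sqrt_pos.2 ht
  have hSsq : S₀ ^ 2 = u t := Real.sq_sqrt ht.le
  have huM : u t ≤ Λ + 4 := by
    have := sin_sq_le_one (π * t)
    simp only [hu]; linarith
  have hSM : S₀ ≤ Λ + 4 := by
    by_contra h
    nlinarith
  set U : Set ℝ := {x | 0 < u x} with hU
  have hUo : IsOpen U := isOpen_lt continuous_const hucont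
  have htU : t ∈ U := ht
  set v : ℝ → ℝ := fun x => (u t)⁻¹ * u x with hv
  have hvt : v t = 1 := inv_mul_cancel₀ ht.ne'
  have hvU : Set.MapsTo v U (Set.Ioi 0) := fun x hx => mul_pos (inv_pos.2 ht) hx
  have hvs : ContDiff ℝ s v := contDiff_const.mul husmooth
  have hsqrt : ContDiffOn ℝ s (fun x => √x) (Set.Ioi 0) := fun x hx =>
    (Real.contDiffAt_sqrt (ne_of_gt hx)).contDiffWithinAt
  have hDv : ∀ i, 1 ≤ i → ‖iteratedDeriv i v t‖ ≤ (D₁ / S₀) ^ i := by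
    intro i hi
    rw [hv, iteratedDeriv_const_mul_field, norm_mul, norm_inv, Real.norm_of_nonneg ht.le,
      Real.norm_eq_abs, ← hSsq]
    rcases hi.eq_or_lt with rfl | hi2
    · rw [iteratedDeriv_one, pow_one]
      calc (S₀ ^ 2)⁻¹ * |deriv u t| ≤ (S₀ ^ 2)⁻¹ * (4 * π * S₀) := by
            gcongr; exact abs_deriv_sin_sq_le hc t
        _ = 4 * π * 1 / S₀ := by field_simp
        _ ≤ D₁ / S₀ := by rw [hD₁]; gcongr; linarith
    · obtain ⟨j, rfl⟩ : ∃ j, i = j + 2 := ⟨i - 2, by omega⟩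
      calc (S₀ ^ 2)⁻¹ * |iteratedDeriv (j + 2) u t| ≤ (S₀ ^ 2)⁻¹ * (2 * (2 * π) ^ (j + 2)) := by
            gcongr; exact abs_iteratedDeriv_sin_sq_le c t hi
        _ = 2 ^ 1 * (2 * π) ^ (j + 2) * (S₀ ^ j * 1 ^ 2) / S₀ ^ (j + 2) := by
            field_simp; ring
        _ ≤ 2 ^ (j + 2) * (2 * π) ^ (j + 2) * ((Λ + 4) ^ j * (Λ + 4) ^ 2) / S₀ ^ (j + 2) := by
            gcongr
            · norm_num
            · linarith
        _ = (D₁ / S₀) ^ (j + 2) := by rw [hD₁, div_pow, ← mul_pow, ← pow_add, ← mul_pow]; ring_nf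
  set w : ℝ → ℝ := (fun x => √x) ∘ v with hw
  have hwt : w t = 1 := by simp [hw, hvt]
  have hws : ContDiffOn ℝ s w U := hsqrt.comp hvs.contDiffOn hvU
  have hwU : Set.MapsTo w U (Set.Ioi 0) := fun x hx => Real.sqrt_pos.2 (hvU hx)
  have hDw : ∀ i, 1 ≤ i → i ≤ s → ‖iteratedDeriv i w t‖ ≤ (D₂ / S₀) ^ i := by
    intro i hi his
    have his' : ((i : ℕ) : WithTop ℕ∞) ≤ s := by exact_mod_cast his
    refine (norm_iteratedDeriv_comp_le hUo isOpen_Ioi (hsqrt.of_le his')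
      (hvs.of_le his').contDiffOn hvU htU (C := Q) (fun j hj => by
        rw [hvt]; exact hQi j (hj.trans his)) fun j hj _ => hDv j hj).trans ?_
    have h1 : (1 : ℝ) ≤ s.factorial := by exact_mod_cast s.factorial_pos
    have h2 : (i.factorial : ℝ) ≤ s.factorial := by exact_mod_cast Nat.factorial_le his
    calc (i.factorial : ℝ) * Q * (D₁ / S₀) ^ i ≤ (s.factorial * (Q + 1)) * (D₁ / S₀) ^ i := by
          gcongr; linarith
      _ ≤ (s.factorial * (Q + 1)) ^ i * (D₁ / S₀) ^ i := by
          gcongr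
          exact le_self_pow₀ (by nlinarith) (by omega)
      _ = (D₂ / S₀) ^ i := by rw [← mul_pow, hD₂]; ring
  set a : ℝ := κ * S₀ with ha
  have ha0 : 0 < a := by positivity
  set ψ : ℝ → E := fun x => -φ a + φ (a * x) with hψ
  have hψs : ContDiffOn ℝ s ψ (Set.Ioi 0) := by
    refine contDiffOn_const.add ((hφ.of_le (by exact_mod_cast hsm)).comp
      (contDiff_const.mul contDiff_id).contDiffOn fun x hx => ?_)
    exact (mul_pos ha0 hx).le
  have hDψ : ∀ i ≤ s, ‖iteratedDeriv i ψ (w t)‖ ≤ Cφ * a := by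
    intro i hi
    rw [hwt]
    rcases Nat.eq_zero_or_pos i with rfl | hi0
    · simp only [iteratedDeriv_zero, hψ, mul_one, neg_add_cancel, norm_zero]; positivity
    · rw [hψ, iteratedDeriv_const_add hi0, iteratedDeriv_comp_mul_left, norm_smul, norm_pow,
        Real.norm_of_nonneg ha0.le, mul_one]
      exact hCφ i hi0 hi a ha0
  have hG : (fun t => φ (κ * √(u t))) = fun x => φ a + (ψ ∘ w) x := by
    funext x
    simp only [hψ, hw, hv, Function.comp, add_neg_cancel_left]
    rw [Real.sqrt_mul (inv_nonneg.2 ht.le), Real.sqrt_inv, ha, ← hS₀]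
    congr 1
    field_simp
  refine ⟨?_, ?_⟩
  · rw [hG]
    exact contDiffAt_const.add ((hψs.comp hws hwU).contDiffAt (hUo.mem_nhds htU))
  · rw [hG, iteratedDeriv_const_add (by omega)]
    refine (norm_iteratedDeriv_comp_le hUo isOpen_Ioi hψs hws hwU htU hDψ hDw).trans_eq ?_
    obtain ⟨r, rfl⟩ : ∃ r, s = r + 1 := ⟨s - 1, by omega⟩
    rw [Nat.add_sub_cancel, ha, div_pow]
    field_simp
    ring

end calculus

section differences
variable {E : Type*} [NormedAddCommGroup E] [NormedSpace ℝ E]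

lemma ContDiffAt.differentiableAt_iteratedDeriv {f : ℝ → E} {x : ℝ} {n : ℕ}
    (hf : ContDiffAt ℝ (n + 1 : ℕ) f x) : DifferentiableAt ℝ (iteratedDeriv n f) x := by
  rw [iteratedDeriv_eq_equiv_comp]
  exact (LinearIsometryEquiv.differentiable _ _).comp x
    ((hf.iteratedFDeriv_right (m := 1) (i := n) (by norm_cast; omega)).differentiableAt (by simp))

lemma norm_fwdDiff_iter_le_of_deriv {h : ℝ} (hh : 0 ≤ h) {n : ℕ} {f : ℝ → E} {a M : ℝ}
    (hf : ∀ x ∈ Set.Icc a (a + n * h), ContDiffAt ℝ n f x)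
    (hM : ∀ x ∈ Set.Icc a (a + n * h), ‖iteratedDeriv n f x‖ ≤ M) :
    ‖(fwdDiff h)^[n] f a‖ ≤ M * h ^ n := by
  induction n generalizing f M with
  | zero => simpa using hM a (by simp)
  | succ n ih =>
    rw [Function.iterate_succ_apply]
    have hmem : ∀ x ∈ Set.Icc a (a + n * h), Set.Icc x (x + h) ⊆ Set.Icc a (a + (n + 1 : ℕ) * h) :=
      fun x hx y hy => ⟨hx.1.trans hy.1, by push_cast; linarith [hx.2, hy.2]⟩
    have hsh : ∀ x ∈ Set.Icc a (a + n * h), ContDiffAt ℝ n (fun y => f (y + h)) x := fun x hx =>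
      ContDiffAt.comp x (g := f) ((hf (x + h) (hmem x hx ⟨by linarith, le_rfl⟩)).of_le
        (by norm_cast; omega)) (contDiffAt_id.add contDiffAt_const)
    have hid : ∀ x ∈ Set.Icc a (a + n * h), ContDiffAt ℝ n f x := fun x hx =>
      (hf x (hmem x hx ⟨le_rfl, by linarith⟩)).of_le (by norm_cast; omega)
    rw [pow_succ', ← mul_assoc]
    refine ih (fun x hx => (hsh x hx).sub (hid x hx)) fun x hx => ?_
    have : iteratedDeriv n (fwdDiff h f) x = iteratedDeriv n f (x + h) - iteratedDeriv n f x := by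
      have := iteratedDeriv_sub (hsh x hx) (hid x hx)
      rw [iteratedDeriv_comp_add_const] at this
      exact this
    rw [this]
    have h2 := (convex_Icc x (x + h)).norm_image_sub_le_of_norm_deriv_le (𝕜 := ℝ) (C := M)
      (f := iteratedDeriv n f) (x := x) (y := x + h)
      (fun y hy => (hf y (hmem x hx hy)).differentiableAt_iteratedDeriv)
      (fun y hy => by rw [← iteratedDeriv_succ]; exact hM y (hmem x hx hy))
      ⟨le_rfl, by linarith⟩ ⟨by linarith, le_rfl⟩
    rwa [add_sub_cancel_left, Real.norm_of_nonneg hh] at h2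

lemma norm_fwdDiff_iter_le {F G : Type*} [NormedAddCommGroup F] [AddCommMonoid G] (h : G)
    (n : ℕ) {f : G → F} {M : ℝ}
    (hM : ∀ x, ‖f x‖ ≤ M) (x : G) : ‖(fwdDiff h)^[n] f x‖ ≤ 2 ^ n * M := by
  induction n generalizing f M with
  | zero => simpa using hM x
  | succ n ih =>
    rw [Function.iterate_succ_apply, pow_succ, mul_assoc]
    refine ih fun y => ?_
    calc ‖f (y + h) - f y‖ ≤ ‖f (y + h)‖ + ‖f y‖ := norm_sub_le _ _
      _ ≤ 2 * M := by linarith [hM (y + h), hM y]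

/-- A compactly supported function which is `C¹` up to the origin is Lipschitz. -/
lemma exists_norm_sub_le_of_contDiffOn {φ : ℝ → E} {m : ℕ} (hm : 1 ≤ m)
    (hφ : ContDiffOn ℝ m φ (Set.Ici 0)) (hφc : HasCompactSupport φ) :
    ∃ L : ℝ, 0 ≤ L ∧ ∀ a, 0 ≤ a → ∀ b, 0 ≤ b → ‖φ a - φ b‖ ≤ L * |a - b| := by
  obtain ⟨C, hC0, hC⟩ := exists_norm_pow_smul_iteratedDeriv_le hm hφ hφc
  refine ⟨C, hC0, ?_⟩
  have hpos : ∀ a ∈ Set.Ioi (0 : ℝ), ∀ b ∈ Set.Ioi (0 : ℝ), ‖φ a - φ b‖ ≤ C * |a - b| := by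
    intro a ha b hb
    refine (convex_Ioi (0 : ℝ)).norm_image_sub_le_of_norm_deriv_le (𝕜 := ℝ) (fun y hy =>
      (hφ.contDiffAt (Ici_mem_nhds hy)).differentiableAt ?_) (fun y hy => ?_) hb ha
    · norm_cast; omega
    · have hy' : (0 : ℝ) < y := hy
      have := hC 1 le_rfl le_rfl y hy
      rw [iteratedDeriv_one, pow_one, mul_comm] at this
      exact le_of_mul_le_mul_right this hy'
  have hcl : Set.Ici (0 : ℝ) ×ˢ Set.Ici (0 : ℝ) ⊆
      closure (Set.Ioi (0 : ℝ) ×ˢ Set.Ioi (0 : ℝ)) := by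
    rw [closure_prod_eq, closure_Ioi]
  have hφ' := hφ.continuousOn
  intro a ha b hb
  refine ContinuousWithinAt.closure_le (s := Set.Ioi (0 : ℝ) ×ˢ Set.Ioi (0 : ℝ))
    (f := fun x : ℝ × ℝ => ‖φ x.1 - φ x.2‖) (g := fun x : ℝ × ℝ => C * |x.1 - x.2|)
    (x := (a, b)) (hcl ⟨ha, hb⟩) ?_ (by fun_prop) fun x hx => hpos x.1 hx.1 x.2 hx.2
  have h1 : ContinuousWithinAt (fun x : ℝ × ℝ => φ x.1)
      (Set.Ioi (0 : ℝ) ×ˢ Set.Ioi (0 : ℝ)) (a, b) :=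
    ContinuousWithinAt.comp (t := Set.Ici 0) (g := φ) (hφ' a ha) (by fun_prop)
      fun x hx => Set.mem_Ici.2 (le_of_lt hx.1)
  have h2 : ContinuousWithinAt (fun x : ℝ × ℝ => φ x.2)
      (Set.Ioi (0 : ℝ) ×ˢ Set.Ioi (0 : ℝ)) (a, b) :=
    ContinuousWithinAt.comp (t := Set.Ici 0) (g := φ) (hφ' b hb) (by fun_prop)
      fun x hx => Set.mem_Ici.2 (le_of_lt hx.2)
  exact (h1.sub h2).norm

lemma abs_sqrt_add_sq_sub_le {c : ℝ} (hc : 0 ≤ c) (a b : ℝ) :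
    |√(c + a ^ 2) - √(c + b ^ 2)| ≤ |a - b| := by
  have key : ∀ a b : ℝ, √(c + a ^ 2) ≤ √(c + b ^ 2) + |a - b| := fun a b => by
    have h0 := Real.sqrt_nonneg (c + b ^ 2)
    have h1 : |b| ≤ √(c + b ^ 2) := Real.abs_le_sqrt (by linarith)
    refine Real.sqrt_le_iff.2 ⟨by positivity, ?_⟩
    have h2 : √(c + b ^ 2) ^ 2 = c + b ^ 2 := Real.sq_sqrt (by positivity)
    have h3 : |b| * |a - b| ≤ √(c + b ^ 2) * |a - b| := by gcongr
    have h4 : b * (a - b) ≤ |b| * |a - b| := by rw [← abs_mul]; exact le_abs_self _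
    have h5 : |a - b| ^ 2 = (a - b) ^ 2 := sq_abs _
    nlinarith
  rw [abs_sub_le_iff]
  constructor
  · linarith [key a b]
  · rw [abs_sub_comm a b]; linarith [key b a]

lemma abs_sqrt_sin_sub_le {c : ℝ} (hc : 0 ≤ c) (x y : ℝ) :
    |√(c + 4 * sin (π * x) ^ 2) - √(c + 4 * sin (π * y) ^ 2)| ≤ 2 * π * |x - y| := by
  have h := abs_sqrt_add_sq_sub_le hc (2 * sin (π * x)) (2 * sin (π * y))
  rw [mul_pow, mul_pow, show (2 : ℝ) ^ 2 = 4 by norm_num] at h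
  refine h.trans ?_
  rw [← mul_sub, abs_mul, abs_two, mul_assoc]
  gcongr
  have := Real.abs_sin_sub_sin_le (π * x) (π * y)
  rwa [← mul_sub, abs_mul, abs_of_pos pi_pos] at this

lemma le_two_mul_abs_sin {m x : ℝ} (hm : m ≤ 1 / 2) (hx : m ≤ 2 * |x|) (hx' : |x| ≤ 3 / 4) :
    m ≤ 2 * |sin (π * x)| := by
  have hb : ∀ y, 0 ≤ y → y ≤ 1 / 2 → 2 * y ≤ sin (π * y) := fun y h0 h1 => by
    have := Real.mul_le_sin (x := π * y) (by positivity) (by nlinarith [pi_pos])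
    calc 2 * y = 2 / π * (π * y) := by field_simp
      _ ≤ _ := this
  have he : |sin (π * x)| = |sin (π * |x|)| := by
    rcases abs_choice x with h | h <;> rw [h]
    rw [mul_neg, sin_neg, abs_neg]
  rw [he]
  rcases le_total |x| (1 / 2) with h | h
  · have := hb |x| (abs_nonneg _) h
    have h2 := le_abs_self (sin (π * |x|))
    linarith [abs_nonneg x]
  · have := hb (1 - |x|) (by linarith) (by linarith)
    rw [show π * (1 - |x|) = π - π * |x| by ring, sin_pi_sub] at this
    have h2 := le_abs_self (sin (π * |x|))
    linarith

lemma SinD_add_single (d : ℕ) (ξ : Fin d → ℝ) (i : Fin d) (t : ℝ) :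
    SinD d (ξ + Pi.single i t) = √((4 * ∑ j ∈ Finset.univ.erase i, sin (π * ξ j) ^ 2)
      + 4 * sin (π * (ξ i + t)) ^ 2) := by
  rw [SinD, ← Finset.sum_erase_add _ _ (Finset.mem_univ i), mul_add]
  have h : ∑ j ∈ Finset.univ.erase i, sin (π * (ξ + Pi.single i t : Fin d → ℝ) j) ^ 2
      = ∑ j ∈ Finset.univ.erase i, sin (π * ξ j) ^ 2 := Finset.sum_congr rfl fun j hj => by
    simp [Pi.single_eq_of_ne (Finset.ne_of_mem_erase hj)]
  rw [h]
  simp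

lemma fwdDiff_iter_single {F : Type*} [AddCommGroup F] {d : ℕ} (φ : ℝ → F) (κ h : ℝ) (ξ : Fin d → ℝ) (i : Fin d) (s : ℕ) :
    (fwdDiff (Pi.single i h))^[s] (fun ξ => φ (κ * SinD d ξ)) ξ
      = (fwdDiff h)^[s] (fun t => φ (κ * √((4 * ∑ j ∈ Finset.univ.erase i, sin (π * ξ j) ^ 2)
      + 4 * sin (π * t) ^ 2))) (ξ i) := by
  rw [fwdDiff_iter_eq_sum_shift, fwdDiff_iter_eq_sum_shift]
  refine Finset.sum_congr rfl fun k _ => ?_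
  rw [← SinD_add_single d ξ i, ← Pi.single_smul]

/-- Pointwise bounds for the finite differences of a dilated radial multiplier. -/
lemma exists_norm_fwdDiff_iter_le (d : ℕ) {φ : ℝ → E} {s m : ℕ} (hs : 1 ≤ s) (hsm : s ≤ m)
    (hφ : ContDiffOn ℝ m φ (Set.Ici 0)) (hφc : HasCompactSupport φ) :
    ∃ C : ℝ, 0 ≤ C ∧ ∀ κ, 0 < κ → ∀ h, 0 < h → ∀ ξ : Fin d → ℝ, ‖ξ‖ ≤ 1 / 2 → ∀ i,
      ‖(fwdDiff (Pi.single i h))^[s] (fun ξ => φ (κ * SinD d ξ)) ξ‖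
        ≤ C * κ * h / (1 + ‖ξ‖ / h) ^ (s - 1) := by
  obtain ⟨L, hL0, hL⟩ := exists_norm_sub_le_of_contDiffOn (hs.trans hsm) hφ hφc
  obtain ⟨C, hC0, hC⟩ := exists_norm_iteratedDeriv_comp_sqrt_le hs hsm hφ hφc
    (Λ := 4 * d) (by positivity)
  obtain ⟨r, rfl⟩ : ∃ r, s = r + 1 := ⟨s - 1, by omega⟩
  simp only [Nat.add_sub_cancel] at hC ⊢
  refine ⟨2 ^ r * (L * (2 * π)) * (1 + 2 * (r + 1 : ℕ)) ^ r + C * 2 ^ r, by positivity,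
    fun κ hκ h hh ξ hξ i => ?_⟩
  rw [fwdDiff_iter_single]
  set c : ℝ := 4 * ∑ j ∈ Finset.univ.erase i, sin (π * ξ j) ^ 2 with hc
  have hc0 : 0 ≤ c := by positivity
  have hcd : c ≤ 4 * d := by
    rw [hc]
    gcongr
    calc ∑ j ∈ Finset.univ.erase i, sin (π * ξ j) ^ 2 ≤ ∑ j ∈ Finset.univ.erase i, (1 : ℝ) :=
          Finset.sum_le_sum fun j _ => sin_sq_le_one _
      _ ≤ ∑ j : Fin d, (1 : ℝ) :=
          Finset.sum_le_sum_of_subset_of_nonneg (Finset.subset_univ _) fun _ _ _ => zero_le_one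
      _ = d := by simp
  have hden : 0 < (1 + ‖ξ‖ / h) ^ r := by positivity
  rw [le_div_iff₀ hden]
  rcases le_or_gt ‖ξ‖ (2 * (r + 1 : ℕ) * h) with hn | hn
  · rw [Function.iterate_succ_apply]
    have h1 := norm_fwdDiff_iter_le h r (f := fwdDiff h fun t => φ (κ * √(c + 4 * sin (π * t) ^ 2)))
      (M := L * (κ * (2 * π * h))) (fun x => by
        refine (hL _ (by positivity) _ (by positivity)).trans ?_
        rw [← mul_sub, abs_mul, abs_of_pos hκ]
        gcongr
        refine (abs_sqrt_sin_sub_le hc0 _ _).trans_eq ?_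
        rw [add_sub_cancel_left, abs_of_pos hh]) (ξ i)
    have h2 : ‖ξ‖ / h ≤ 2 * (r + 1 : ℕ) := by rwa [div_le_iff₀ hh]
    calc _ ≤ 2 ^ r * (L * (κ * (2 * π * h))) * (1 + 2 * (r + 1 : ℕ)) ^ r := by gcongr
      _ = (2 ^ r * (L * (2 * π)) * (1 + 2 * (r + 1 : ℕ)) ^ r) * κ * h := by ring
      _ ≤ _ := by
          gcongr
          exact le_add_of_nonneg_right (by positivity)
  · have hpos : 0 < ‖ξ‖ := lt_of_le_of_lt (by positivity) hn
    have hrh : (r + 1 : ℕ) * h ≤ ‖ξ‖ / 2 := by linarith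
    have hlow : ∀ x ∈ Set.Icc (ξ i) (ξ i + (r + 1 : ℕ) * h),
        ‖ξ‖ ^ 2 ≤ c + 4 * sin (π * x) ^ 2 := by
      intro x hx
      have hsq : ∀ y : ℝ, ‖ξ‖ ≤ 2 * |sin (π * y)| → ‖ξ‖ ^ 2 ≤ 4 * sin (π * y) ^ 2 := fun y hy => by
        calc ‖ξ‖ ^ 2 ≤ (2 * |sin (π * y)|) ^ 2 := by gcongr
          _ = _ := by rw [mul_pow, sq_abs]; norm_num
      have : Nonempty (Fin d) := ⟨i⟩
      obtain ⟨j, hj⟩ : ∃ j, |ξ j| = ‖ξ‖ := by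
        obtain ⟨j, -, hj⟩ := Finset.exists_mem_eq_sup' Finset.univ_nonempty fun j => ‖ξ j‖₊
        refine ⟨j, ?_⟩
        rw [Pi.norm_def, ← Finset.sup'_eq_sup Finset.univ_nonempty, hj, coe_nnnorm,
          Real.norm_eq_abs]
      by_cases hij : j = i
      · subst hij
        have hx1 : |x - ξ j| ≤ ‖ξ‖ / 2 := by
          rw [abs_of_nonneg (by linarith [hx.1])]; linarith [hx.2]
        have h1 : |ξ j| ≤ |x| + |x - ξ j| := by
          have := abs_sub_abs_le_abs_sub (ξ j) x
          rw [abs_sub_comm (ξ j)] at this; linarith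
        have h2 : |x| ≤ |ξ j| + |x - ξ j| := by
          have := abs_sub_abs_le_abs_sub x (ξ j); linarith
        have := hsq x (le_two_mul_abs_sin hξ (by linarith) (by linarith))
        linarith
      · have h1 := hsq (ξ j) (le_two_mul_abs_sin hξ (by linarith) (by linarith))
        have h2 : sin (π * ξ j) ^ 2 ≤ ∑ j ∈ Finset.univ.erase i, sin (π * ξ j) ^ 2 :=
          Finset.single_le_sum (f := fun j => sin (π * ξ j) ^ 2) (fun _ _ => sq_nonneg _)
            (Finset.mem_erase.2 ⟨hij, Finset.mem_univ _⟩)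
        have h3 := sq_nonneg (sin (π * x))
        linarith
    have h1 := norm_fwdDiff_iter_le_of_deriv hh.le (n := r + 1) (a := ξ i)
      (f := fun t => φ (κ * √(c + 4 * sin (π * t) ^ 2))) (M := C * κ / ‖ξ‖ ^ r)
      (fun x hx => (hC κ hκ c hc0 hcd x ((by positivity : 0 < ‖ξ‖ ^ 2).trans_le (hlow x hx))).1)
      (fun x hx => (hC κ hκ c hc0 hcd x ((by positivity : 0 < ‖ξ‖ ^ 2).trans_le
        (hlow x hx))).2.trans (by
          gcongr
          exact Real.le_sqrt_of_sq_le (hlow x hx)))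
    have h2 : 1 + ‖ξ‖ / h ≤ 2 * (‖ξ‖ / h) := by
      have : 1 ≤ ‖ξ‖ / h := by
        rw [one_le_div hh]
        push_cast at hn
        nlinarith [(by positivity : (0 : ℝ) ≤ r * h)]
      linarith
    calc _ ≤ C * κ / ‖ξ‖ ^ r * h ^ (r + 1) * (2 * (‖ξ‖ / h)) ^ r := by gcongr
      _ = (C * 2 ^ r) * κ * h := by
          rw [mul_pow, div_pow, pow_succ]; field_simp
      _ ≤ _ := by
          gcongr
          exact le_add_of_nonneg_left (by positivity)

end differences

section torus

/-- The normalised Haar measure on the circle. -/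
noncomputable local instance : MeasureSpace UnitAddCircle := ⟨AddCircle.haarAddCircle⟩

local instance : Measure.IsAddHaarMeasure (volume : Measure UnitAddCircle) :=
  inferInstanceAs (Measure.IsAddHaarMeasure AddCircle.haarAddCircle)

local instance : IsProbabilityMeasure (volume : Measure UnitAddCircle) :=
  inferInstanceAs (IsProbabilityMeasure AddCircle.haarAddCircle)

open UnitAddTorus

variable {d : ℕ}

/-- The half-open fundamental domain of the torus. -/
def torusBox (d : ℕ) : Set (Fin d → ℝ) :=
  {x | ∀ i, x i ∈ Set.Ioc (-(1 : ℝ) / 2) (-(1 : ℝ) / 2 + 1)}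

lemma measurableSet_torusBox (d : ℕ) : MeasurableSet (torusBox d) :=
  MeasurableSet.univ_pi' fun _ => measurableSet_Ioc

lemma norm_le_of_mem_torusBox {x : Fin d → ℝ} (hx : x ∈ torusBox d) : ‖x‖ ≤ 1 / 2 := by
  refine (pi_norm_le_iff_of_nonneg (by norm_num)).2 fun i => ?_
  have := hx i
  rw [Real.norm_eq_abs, abs_le]
  constructor <;> linarith [this.1, this.2]

/-- The projection of Euclidean space onto the torus. -/
def toTorus (x : Fin d → ℝ) : UnitAddTorus (Fin d) := fun i => (x i : UnitAddCircle)

lemma toTorus_add (x y : Fin d → ℝ) : toTorus (x + y) = toTorus x + toTorus y := by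
  funext i; simp [toTorus]

lemma toTorus_nsmul (n : ℕ) (x : Fin d → ℝ) : toTorus (n • x) = n • toTorus x := by
  funext i; simp [toTorus]

lemma mFourier_toTorus (n : Fin d → ℤ) (x : Fin d → ℝ) :
    mFourier n (toTorus x) = Complex.exp (2 * π * Complex.I * ∑ j, (n j : ℂ) * (x j : ℂ)) := by
  simp only [mFourier, ContinuousMap.coe_mk, toTorus, fourier_coe_apply, Finset.mul_sum,
    Complex.exp_sum]
  refine Finset.prod_congr rfl fun j _ => ?_
  congr 1
  push_cast
  ring

lemma tsum_enorm_sq_mFourierCoeff {f : UnitAddTorus (Fin d) → ℂ} (hf : Continuous f) :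
    ∑' n, ‖mFourierCoeff f n‖ₑ ^ 2 = ∫⁻ x in torusBox d, ‖f (toTorus x)‖ₑ ^ 2 := by
  set g : C(UnitAddTorus (Fin d), ℂ) := ⟨f, hf⟩ with hg
  have h := hasSum_sq_mFourierCoeff (g.toLp 2 volume ℂ)
  simp_rw [mFourierCoeff_toLp] at h
  have h1 : ∫ t, ‖(g.toLp 2 volume ℂ : UnitAddTorus (Fin d) → ℂ) t‖ ^ 2 = ∫ t, ‖f t‖ ^ 2 := by
    refine integral_congr_ae ?_
    filter_upwards [ContinuousMap.coeFn_toLp (p := 2) (𝕜 := ℂ) volume g] with t ht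
    rw [ht]; rfl
  rw [h1] at h
  have hfint : Integrable (fun t => ‖f t‖ ^ 2) :=
    (hf.norm.pow 2).integrable_of_hasCompactSupport (HasCompactSupport.of_compactSpace _)
  have e : ∀ z : ℂ, ‖z‖ₑ ^ 2 = ENNReal.ofReal (‖z‖ ^ 2) := fun z => by
    rw [ENNReal.ofReal_pow (norm_nonneg _), ofReal_norm]
  have := lintegral_preimage (fun t => ‖f t‖ₑ ^ 2) (fun _ : Fin d => -(1 : ℝ) / 2)
  refine Eq.trans ?_ this
  simp_rw [e]
  rw [← ofReal_integral_eq_lintegral_ofReal hfint (Filter.Eventually.of_forall fun _ =>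
    by positivity), ← h.tsum_eq, ENNReal.ofReal_tsum_of_nonneg (fun _ => by positivity) h.summable]
  rfl

lemma mFourier_add_apply (n : Fin d → ℤ) (x y : UnitAddTorus (Fin d)) :
    mFourier n (x + y) = mFourier n x * mFourier n y := by
  simp only [mFourier, ContinuousMap.coe_mk, Pi.add_apply, fourier_apply, smul_add,
    AddCircle.toCircle_add, Circle.coe_mul, Finset.prod_mul_distrib]

lemma mFourierCoeff_comp_add (f : UnitAddTorus (Fin d) → ℂ) (v : UnitAddTorus (Fin d))
    (n : Fin d → ℤ) :
    mFourierCoeff (fun x => f (x + v)) n = mFourier n v * mFourierCoeff f n := by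
  simp only [mFourierCoeff, smul_eq_mul]
  rw [← integral_add_right_eq_self (fun x => mFourier (-n) x * f x) v, ← integral_const_mul]
  refine integral_congr_ae (Filter.Eventually.of_forall fun x => ?_)
  have : mFourier n v * mFourier (-n) v = 1 := by
    rw [← mFourier_add, add_neg_cancel, mFourier_zero]; rfl
  simp only [mFourier_add_apply]
  linear_combination (-mFourier (-n) x * f (x + v)) * this

lemma integrable_mFourier_mul {f : UnitAddTorus (Fin d) → ℂ} (hf : Continuous f) (n : Fin d → ℤ) :
    Integrable fun x => mFourier n x * f x :=
  ((mFourier n).continuous.mul hf).integrable_of_hasCompactSupport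
    (HasCompactSupport.of_compactSpace _)

lemma mFourierCoeff_sub {f g : UnitAddTorus (Fin d) → ℂ} (hf : Continuous f) (hg : Continuous g)
    (n : Fin d → ℤ) :
    mFourierCoeff (fun x => f x - g x) n = mFourierCoeff f n - mFourierCoeff g n := by
  simp only [mFourierCoeff, smul_eq_mul, mul_sub]
  exact integral_sub (integrable_mFourier_mul hf _) (integrable_mFourier_mul hg _)

lemma continuous_fwdDiff_iter {f : UnitAddTorus (Fin d) → ℂ} (hf : Continuous f)
    (v : UnitAddTorus (Fin d)) (s : ℕ) : Continuous ((fwdDiff v)^[s] f) := by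
  induction s generalizing f with
  | zero => exact hf
  | succ s ih =>
    rw [Function.iterate_succ_apply]
    exact ih ((hf.comp (continuous_add_const v)).sub hf)

lemma mFourierCoeff_fwdDiff_iter {f : UnitAddTorus (Fin d) → ℂ} (hf : Continuous f)
    (v : UnitAddTorus (Fin d)) (s : ℕ) (n : Fin d → ℤ) :
    mFourierCoeff ((fwdDiff v)^[s] f) n = (mFourier n v - 1) ^ s * mFourierCoeff f n := by
  induction s with
  | zero => simp
  | succ s ih =>
    rw [Function.iterate_succ_apply']
    have hc := continuous_fwdDiff_iter hf v s
    refine (mFourierCoeff_sub (hc.comp (continuous_add_const v)) hc n).trans ?_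
    have := mFourierCoeff_comp_add ((fwdDiff v)^[s] f) v n
    rw [Function.comp_def, this, ih]
    ring

lemma mFourierCoeff_mFourier_mul (f : UnitAddTorus (Fin d) → ℂ) (m n : Fin d → ℤ) :
    mFourierCoeff (fun x => mFourier m x * f x) n = mFourierCoeff f (n - m) := by
  simp only [mFourierCoeff, smul_eq_mul]
  refine integral_congr_ae (Filter.Eventually.of_forall fun x => ?_)
  simp only
  rw [← mul_assoc, ← mFourier_add]
  congr 3
  abel

lemma norm_mFourier_apply_le (n : Fin d → ℤ) (x : UnitAddTorus (Fin d)) : ‖mFourier n x‖ ≤ 1 :=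
  ((mFourier n).norm_coe_le_norm x).trans mFourier_norm.le

lemma norm_mFourierCoeff_le {f : UnitAddTorus (Fin d) → ℂ} {S : ℝ} (hf : ∀ x, ‖f x‖ ≤ S)
    (n : Fin d → ℤ) : ‖mFourierCoeff f n‖ ≤ S := by
  refine (norm_integral_le_of_norm_le_const (C := S)
    (Filter.Eventually.of_forall fun x => ?_)).trans (by simp)
  rw [norm_smul]
  exact (mul_le_of_le_one_left (norm_nonneg _) (norm_mFourier_apply_le _ _)).trans (hf x)

end torus

section multiplier

open UnitAddTorus

variable {d : ℕ}

/-- The function `Sin` on the torus. -/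
noncomputable def torusSin (x : UnitAddTorus (Fin d)) : ℝ :=
  √(∑ j, ‖fourier 1 (x j) - 1‖ ^ 2)

lemma continuous_torusSin : Continuous (torusSin (d := d)) := by
  unfold torusSin; fun_prop

lemma torusSin_toTorus (x : Fin d → ℝ) : torusSin (toTorus x) = SinD d x := by
  unfold torusSin SinD
  rw [Finset.mul_sum]
  congr 1
  refine Finset.sum_congr rfl fun j _ => ?_
  have : fourier 1 (toTorus x j) = Complex.exp (Complex.I * ((2 * π * x j : ℝ) : ℂ)) := by
    simp only [toTorus, fourier_coe_apply]
    congr 1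
    push_cast
    ring
  rw [this, Complex.norm_exp_I_mul_ofReal_sub_one, Real.norm_eq_abs, sq_abs]
  rw [show 2 * π * x j / 2 = π * x j by ring]
  ring

/-- The dilated multiplier `φ (κ Sin)` on the torus. -/
noncomputable def dilMult (d : ℕ) (φ : ℝ → ℂ) (κ : ℝ) (x : UnitAddTorus (Fin d)) : ℂ :=
  φ (κ * torusSin x)

/-- The convolution kernel of the multiplier `φ (κ Sin)`. -/
noncomputable def latKernel (d : ℕ) (φ : ℝ → ℂ) (κ : ℝ) (n : Fin d → ℤ) : ℂ :=
  mFourierCoeff (dilMult d φ κ) n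

lemma continuous_dilMult {φ : ℝ → ℂ} (hφ : ContinuousOn φ (Set.Ici 0)) {κ : ℝ} (hκ : 0 < κ) :
    Continuous (dilMult d φ κ) :=
  hφ.comp_continuous (continuous_const.mul continuous_torusSin) fun _ =>
    mul_nonneg hκ.le (Real.sqrt_nonneg _)

lemma dilMult_toTorus (φ : ℝ → ℂ) (κ : ℝ) (x : Fin d → ℝ) :
    dilMult d φ κ (toTorus x) = φ (κ * SinD d x) := by
  rw [dilMult, torusSin_toTorus]

lemma fwdDiff_iter_toTorus (F : UnitAddTorus (Fin d) → ℂ) (v x : Fin d → ℝ) (s : ℕ) :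
    (fwdDiff (toTorus v))^[s] F (toTorus x) = (fwdDiff v)^[s] (fun y => F (toTorus y)) x := by
  simp only [fwdDiff_iter_eq_sum_shift, toTorus_add, toTorus_nsmul]

lemma lintegral_comp_inv_smul (f : (Fin d → ℝ) → ℝ≥0∞) {h : ℝ} (hh : 0 < h) :
    ∫⁻ x, f (h⁻¹ • x) = ENNReal.ofReal (h ^ d) * ∫⁻ x, f x := by
  have h0 : h⁻¹ ≠ 0 := (inv_pos.2 hh).ne'
  have := lintegral_map_equiv (μ := (volume : Measure (Fin d → ℝ))) f
    (Homeomorph.smulOfNeZero h⁻¹ h0).toMeasurableEquiv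
  have e : (⇑(Homeomorph.smulOfNeZero (α := Fin d → ℝ) h⁻¹ h0).toMeasurableEquiv) =
    (h⁻¹ • ·) := rfl
  rw [e, Measure.map_addHaar_smul _ h0, lintegral_smul_measure] at this
  rw [← this, Module.finrank_fin_fun, inv_pow, inv_inv, abs_of_pos (by positivity), smul_eq_mul]

lemma mFourier_single_toTorus (n : Fin d → ℤ) (i : Fin d) (h : ℝ) :
    mFourier n (toTorus (Pi.single i h)) = Complex.exp (Complex.I * ((2 * π * h * n i : ℝ) : ℂ)) := by
  rw [mFourier_toTorus, Finset.sum_eq_single i]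
  · simp only [Pi.single_eq_same]
    congr 1
    push_cast
    ring
  · intro j _ hj
    simp [hj]
  · simp

lemma norm_le_SinD {ξ : Fin d → ℝ} (hξ : ξ ∈ torusBox d) : ‖ξ‖ ≤ SinD d ξ := by
  have hle := norm_le_of_mem_torusBox hξ
  refine (pi_norm_le_iff_of_nonneg (Real.sqrt_nonneg _)).2 fun i => ?_
  have hi : |ξ i| ≤ 1 / 2 := (norm_le_pi_norm ξ i).trans hle
  rw [Real.norm_eq_abs]
  have h1 := le_two_mul_abs_sin (m := |ξ i|) hi (by linarith [abs_nonneg (ξ i)]) (by linarith)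
  refine h1.trans (Real.le_sqrt_of_sq_le ?_)
  rw [mul_pow, sq_abs]
  have := Finset.single_le_sum (f := fun j => sin (π * ξ j) ^ 2) (fun j _ => sq_nonneg _)
    (Finset.mem_univ i)
  linarith

end multiplier

section kernel

open UnitAddTorus

variable {d : ℕ} {φ : ℝ → ℂ}

lemma tsum_diff_latKernel_sq_le {s : ℕ} (hs : 1 ≤ s) (hds : d + 1 ≤ 2 * (s - 1)) {m : ℕ}
    (hsm : s ≤ m) (hφ : ContDiffOn ℝ m φ (Set.Ici 0)) (hφc : HasCompactSupport φ) :
    ∃ C : ℝ, 0 ≤ C ∧ ∀ κ : ℝ, 0 < κ → ∀ h : ℝ, 0 < h → ∀ i : Fin d,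
      ∑' n, (‖Complex.exp (Complex.I * ((2 * π * h * n i : ℝ) : ℂ)) - 1‖ₑ ^ s *
        ‖latKernel d φ κ n‖ₑ) ^ 2 ≤ ENNReal.ofReal (C * κ ^ 2 * h ^ (d + 2)) := by
  obtain ⟨C, hC, hb⟩ := exists_norm_fwdDiff_iter_le d hs hsm hφ hφc
  set J : ℝ≥0∞ := ∫⁻ x : Fin d → ℝ, ENNReal.ofReal ((1 + ‖x‖) ^ (-((d : ℝ) + 1))) with hJ
  have hJtop : J ≠ ∞ := (finite_integral_one_add_norm (E := Fin d → ℝ) (r := (d : ℝ) + 1)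
    (by simp)).ne
  refine ⟨C ^ 2 * J.toReal, by positivity, fun κ hκ h hh i => ?_⟩
  have hF : Continuous (dilMult d φ κ) := continuous_dilMult hφ.continuousOn hκ
  set v : UnitAddTorus (Fin d) := toTorus (Pi.single i h) with hv
  have e1 : ∀ n, (‖Complex.exp (Complex.I * ((2 * π * h * n i : ℝ) : ℂ)) - 1‖ₑ ^ s *
        ‖latKernel d φ κ n‖ₑ) ^ 2 = ‖mFourierCoeff ((fwdDiff v)^[s] (dilMult d φ κ)) n‖ₑ ^ 2 := by
    intro n
    rw [mFourierCoeff_fwdDiff_iter hF, hv, mFourier_single_toTorus, enorm_mul, enorm_pow]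
    rfl
  simp_rw [e1]
  rw [tsum_enorm_sq_mFourierCoeff (continuous_fwdDiff_iter hF v s)]
  have key : ∀ ξ ∈ torusBox d, ‖(fwdDiff v)^[s] (dilMult d φ κ) (toTorus ξ)‖ₑ ^ 2 ≤
      ENNReal.ofReal ((C * κ * h) ^ 2) *
        ENNReal.ofReal ((1 + ‖h⁻¹ • ξ‖) ^ (-((d : ℝ) + 1))) := by
    intro ξ hξ
    have h1 := hb κ hκ h hh ξ (norm_le_of_mem_torusBox hξ) i
    rw [hv, fwdDiff_iter_toTorus]
    simp_rw [dilMult_toTorus]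
    rw [← ofReal_norm, ← ENNReal.ofReal_pow (norm_nonneg _), ← ENNReal.ofReal_mul (sq_nonneg _)]
    refine ENNReal.ofReal_le_ofReal ((pow_le_pow_left₀ (norm_nonneg _) h1 2).trans ?_)
    rw [norm_smul, Real.norm_of_nonneg (inv_nonneg.2 hh.le), ← div_eq_inv_mul, div_pow, ← pow_mul,
      div_eq_mul_inv]
    refine mul_le_mul_of_nonneg_left ?_ (sq_nonneg _)
    have h2 : (1 : ℝ) ≤ 1 + ‖ξ‖ / h := by
      have : 0 ≤ ‖ξ‖ / h := by positivity
      linarith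
    rw [Real.rpow_neg (by linarith)]
    refine inv_anti₀ (by positivity) ?_
    rw [show (d : ℝ) + 1 = ((d + 1 : ℕ) : ℝ) by push_cast; ring, Real.rpow_natCast]
    exact pow_le_pow_right₀ h2 (by omega)
  calc ∫⁻ x in torusBox d, ‖(fwdDiff v)^[s] (dilMult d φ κ) (toTorus x)‖ₑ ^ 2
      ≤ ∫⁻ x in torusBox d, ENNReal.ofReal ((C * κ * h) ^ 2) *
        ENNReal.ofReal ((1 + ‖h⁻¹ • x‖) ^ (-((d : ℝ) + 1))) :=
        setLIntegral_mono' (measurableSet_torusBox d) key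
    _ ≤ ∫⁻ x, ENNReal.ofReal ((C * κ * h) ^ 2) *
        ENNReal.ofReal ((1 + ‖h⁻¹ • x‖) ^ (-((d : ℝ) + 1))) := setLIntegral_le_lintegral _ _
    _ = ENNReal.ofReal ((C * κ * h) ^ 2) * (ENNReal.ofReal (h ^ d) * J) := by
        rw [lintegral_const_mul' _ _ ENNReal.ofReal_ne_top,
          lintegral_comp_inv_smul (fun x => ENNReal.ofReal ((1 + ‖x‖) ^ (-((d : ℝ) + 1)))) hh]
    _ = ENNReal.ofReal (C ^ 2 * J.toReal * κ ^ 2 * h ^ (d + 2)) := by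
        nth_rw 1 [← ENNReal.ofReal_toReal hJtop]
        rw [← ENNReal.ofReal_mul (by positivity), ← ENNReal.ofReal_mul (by positivity)]
        congr 1
        ring

lemma exists_forall_norm_le_of_hasCompactSupport {m : ℕ} (hφ : ContDiffOn ℝ m φ (Set.Ici 0))
    (hφc : HasCompactSupport φ) : ∃ S : ℝ, 0 ≤ S ∧ ∀ t, 0 ≤ t → ‖φ t‖ ≤ S := by
  obtain ⟨S, hS⟩ := (hφc.isCompact.inter_right isClosed_Ici).exists_bound_of_continuousOn
    (hφ.continuousOn.mono (Set.inter_subset_right (s := tsupport φ)))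
  refine ⟨max S 0, le_max_right _ _, fun t ht => ?_⟩
  by_cases h : t ∈ tsupport φ
  · exact (hS t ⟨h, ht⟩).trans (le_max_left _ _)
  · rw [image_eq_zero_of_notMem_tsupport h, norm_zero]
    exact le_max_right _ _

lemma norm_latKernel_le {S κ : ℝ} (hκ : 0 < κ) (hS : ∀ t, 0 ≤ t → ‖φ t‖ ≤ S) (n : Fin d → ℤ) :
    ‖latKernel d φ κ n‖ ≤ S :=
  norm_mFourierCoeff_le (fun _ => hS _ (mul_nonneg hκ.le (Real.sqrt_nonneg _))) n

lemma exists_forall_eq_zero (hφc : HasCompactSupport φ) :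
    ∃ A : ℝ, 0 < A ∧ ∀ t, A < t → φ t = 0 := by
  obtain ⟨A, hA⟩ := hφc.isCompact.bddAbove
  refine ⟨max A 1, by positivity, fun t ht => ?_⟩
  by_contra h
  exact absurd (hA (subset_tsupport _ h)) (not_le.2 ((le_max_left _ _).trans_lt ht))

lemma enorm_dilMult_sq_le {S A κ : ℝ} (hκ : 0 < κ) (hS : ∀ t, 0 ≤ t → ‖φ t‖ ≤ S)
    (hA : ∀ t, A < t → φ t = 0) {ξ : Fin d → ℝ} (hξ : ξ ∈ torusBox d) :
    ‖dilMult d φ κ (toTorus ξ)‖ₑ ^ 2 ≤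
      (Metric.closedBall 0 (A / κ)).indicator (fun _ => ENNReal.ofReal (S ^ 2)) ξ := by
  rw [dilMult_toTorus]
  by_cases h : ξ ∈ Metric.closedBall 0 (A / κ)
  · rw [Set.indicator_of_mem h, ← ofReal_norm, ← ENNReal.ofReal_pow (norm_nonneg _)]
    exact ENNReal.ofReal_le_ofReal (pow_le_pow_left₀ (norm_nonneg _)
      (hS _ (mul_nonneg hκ.le (Real.sqrt_nonneg _))) 2)
  · rw [mem_closedBall_zero_iff, not_le, div_lt_iff₀' hκ] at h
    rw [hA _ (h.trans_le (mul_le_mul_of_nonneg_left (norm_le_SinD hξ) hκ.le))]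
    simp

/-- Weighted `ℓ²` estimate obtained from the support of the multiplier. -/
lemma tsum_mFourierCoeff_mul_dilMult_sq_le {S A κ W : ℝ} (hκ : 0 < κ) (hA0 : 0 < A)
    (hφ : ContinuousOn φ (Set.Ici 0))
    (hS : ∀ t, 0 ≤ t → ‖φ t‖ ≤ S) (hA : ∀ t, A < t → φ t = 0)
    {w : UnitAddTorus (Fin d) → ℂ} (hw : Continuous w)
    (hwle : ∀ ξ : Fin d → ℝ, ‖ξ‖ ≤ A / κ → ‖w (toTorus ξ)‖ ≤ W) :
    ∑' n, ‖mFourierCoeff (fun x => w x * dilMult d φ κ x) n‖ₑ ^ 2 ≤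
      ENNReal.ofReal (W ^ 2 * S ^ 2 * (2 * A / κ) ^ d) := by
  refine (tsum_enorm_sq_mFourierCoeff (hw.mul (continuous_dilMult hφ hκ))).trans_le ?_
  calc ∫⁻ x in torusBox d, ‖w (toTorus x) * dilMult d φ κ (toTorus x)‖ₑ ^ 2
      ≤ ∫⁻ x in torusBox d, (Metric.closedBall 0 (A / κ)).indicator
          (fun _ => ENNReal.ofReal (W ^ 2 * S ^ 2)) x := by
        refine setLIntegral_mono' (measurableSet_torusBox d) fun ξ hξ => ?_
        have h1 := enorm_dilMult_sq_le hκ hS hA hξ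
        rw [enorm_mul, mul_pow]
        by_cases h : ξ ∈ Metric.closedBall 0 (A / κ)
        · rw [Set.indicator_of_mem h] at h1 ⊢
          rw [ENNReal.ofReal_mul (sq_nonneg _)]
          refine mul_le_mul' ?_ h1
          rw [← ofReal_norm, ← ENNReal.ofReal_pow (norm_nonneg _)]
          exact ENNReal.ofReal_le_ofReal (pow_le_pow_left₀ (norm_nonneg _)
            (hwle ξ (mem_closedBall_zero_iff.1 h)) 2)
        · rw [Set.indicator_of_notMem h] at h1 ⊢
          rw [nonpos_iff_eq_zero.1 h1, mul_zero]
    _ ≤ ∫⁻ x, (Metric.closedBall 0 (A / κ)).indicator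
          (fun _ => ENNReal.ofReal (W ^ 2 * S ^ 2)) x := setLIntegral_le_lintegral _ _
    _ = _ := by
        rw [lintegral_indicator Metric.isClosed_closedBall.measurableSet, setLIntegral_const,
          Real.volume_pi_closedBall _ (by positivity), Fintype.card_fin,
          ← ENNReal.ofReal_mul (by positivity)]
        congr 2
        ring

lemma tsum_latKernel_sq_le {S A κ : ℝ} (hκ : 0 < κ) (hA0 : 0 < A)
    (hφ : ContinuousOn φ (Set.Ici 0))
    (hS : ∀ t, 0 ≤ t → ‖φ t‖ ≤ S) (hA : ∀ t, A < t → φ t = 0) :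
    ∑' n, ‖latKernel d φ κ n‖ₑ ^ 2 ≤ ENNReal.ofReal (S ^ 2 * (2 * A / κ) ^ d) := by
  have := tsum_mFourierCoeff_mul_dilMult_sq_le (d := d) (W := 1) hκ hA0 hφ hS hA
    (w := fun _ => 1) continuous_const (by simp)
  simpa using! this

lemma norm_mFourier_sub_le (x y : Fin d → ℤ) (ξ : Fin d → ℝ) {L : ℝ}
    (hL : ∀ i, |(x i : ℝ) - y i| ≤ L) :
    ‖mFourier y (toTorus ξ) - mFourier x (toTorus ξ)‖ ≤ 2 * π * d * L * ‖ξ‖ := by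
  have h1 : mFourier y (toTorus ξ) - mFourier x (toTorus ξ) = mFourier x (toTorus ξ) *
      (Complex.exp (Complex.I * ((2 * π * ∑ j, ((y j : ℝ) - x j) * ξ j : ℝ) : ℂ)) - 1) := by
    rw [mul_sub, mul_one, mFourier_toTorus, mFourier_toTorus, ← Complex.exp_add]
    congr 2
    push_cast
    simp only [sub_mul, Finset.sum_sub_distrib]
    ring
  have h2 := norm_mFourier_apply_le x (toTorus ξ)
  rw [h1, norm_mul]
  refine (mul_le_of_le_one_left (norm_nonneg _) h2).trans
    (norm_exp_I_mul_ofReal_sub_one_le.trans ?_)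
  rw [norm_mul, Real.norm_of_nonneg Real.two_pi_pos.le,
    show 2 * π * d * L * ‖ξ‖ = 2 * π * (d * (L * ‖ξ‖)) by ring]
  refine mul_le_mul_of_nonneg_left ((norm_sum_le _ _).trans ?_) Real.two_pi_pos.le
  refine (Finset.sum_le_card_nsmul _ _ (L * ‖ξ‖) fun i _ => ?_).trans (by simp)
  rw [norm_mul]
  refine mul_le_mul ?_ (norm_le_pi_norm ξ i) (norm_nonneg _) ((abs_nonneg _).trans (hL i))
  rw [Real.norm_eq_abs, abs_sub_comm]
  exact hL i

lemma tsum_latKernel_sub_sq_le {S A κ L : ℝ} (hκ : 0 < κ) (hA0 : 0 < A)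
    (hφ : ContinuousOn φ (Set.Ici 0))
    (hS : ∀ t, 0 ≤ t → ‖φ t‖ ≤ S) (hA : ∀ t, A < t → φ t = 0) (hL0 : 0 ≤ L) (x y : Fin d → ℤ)
    (hL : ∀ i, |(x i : ℝ) - y i| ≤ L) :
    ∑' n, ‖latKernel d φ κ (n - y) - latKernel d φ κ (n - x)‖ₑ ^ 2 ≤
      ENNReal.ofReal ((2 * π * d * L * (A / κ)) ^ 2 * S ^ 2 * (2 * A / κ) ^ d) := by
  have hF := continuous_dilMult (d := d) hφ hκ
  have := tsum_mFourierCoeff_mul_dilMult_sq_le (d := d) (W := 2 * π * d * L * (A / κ)) hκ hA0 hφ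
    hS hA (w := fun ξ => mFourier y ξ - mFourier x ξ) (by fun_prop) (fun ξ hξ =>
      (norm_mFourier_sub_le x y ξ hL).trans (mul_le_mul_of_nonneg_left hξ (by positivity)))
  refine le_trans (le_of_eq ?_) this
  congr 1
  funext n
  simp only [sub_mul]
  have h1 : mFourierCoeff (fun ξ => mFourier y ξ * dilMult d φ κ ξ -
      mFourier x ξ * dilMult d φ κ ξ) n = _ :=
    mFourierCoeff_sub ((mFourier y).continuous.mul hF) ((mFourier x).continuous.mul hF) n
  have h2 := mFourierCoeff_mFourier_mul (dilMult d φ κ) y n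
  have h3 := mFourierCoeff_mFourier_mul (dilMult d φ κ) x n
  rw [h1]
  exact congrArg (‖·‖ₑ ^ 2) (congrArg₂ (· - ·) h2.symm h3.symm)

end kernel

section convolution

open UnitAddTorus

variable {d : ℕ} {φ : ℝ → ℂ}

lemma continuous_toTorus : Continuous (toTorus (d := d)) :=
  continuous_pi fun i => (AddCircle.continuous_mk' 1).comp (continuous_apply i)

lemma volume_torusBox_lt_top : volume (torusBox d) < ∞ :=
  (measure_mono fun _ hx => mem_closedBall_zero_iff.2 (norm_le_of_mem_torusBox hx)).trans_lt
    (isCompact_closedBall (0 : Fin d → ℝ) (1 / 2)).measure_lt_top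

lemma torusBox_ae_eq_Td : torusBox d =ᵐ[volume] Td d := by
  have : torusBox d = Set.univ.pi fun _ => Set.Ioc (-(1 : ℝ) / 2) (1 / 2) := by
    ext x
    simp only [torusBox, Set.mem_ofPred_eq, Set.mem_univ_pi]
    norm_num
  rw [this, Td, Set.pi_univ_Icc]
  exact Measure.univ_pi_Ioc_ae_eq_Icc

lemma latKernel_eq_integral (κ : ℝ) (n : Fin d → ℤ) :
    latKernel d φ κ n =
      ∫ x in torusBox d, mFourier (-n) (toTorus x) * dilMult d φ κ (toTorus x) :=
  mFourierCoeff_eq_integral (dilMult d φ κ) n fun _ => -(1 : ℝ) / 2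

lemma MpieceZ_eq_latConv {m : ℕ} (hφ : ContDiffOn ℝ m φ (Set.Ici 0))
    (hφc : HasCompactSupport φ) (k : ℤ) {f : (Fin d → ℤ) → ℂ} (hf : Summable fun n => ‖f n‖)
    (n : Fin d → ℤ) :
    MpieceZ d φ k f n = latConv (latKernel d φ (2 ^ (-k))) f n := by
  obtain ⟨S, hS0, hS⟩ := exists_forall_norm_le_of_hasCompactSupport hφ hφc
  set κ : ℝ := 2 ^ (-k) with hκdef
  have hκ : 0 < κ := by positivity
  set F : (Fin d → ℤ) → (Fin d → ℝ) → ℂ := fun l x =>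
    f l * (mFourier (-(n - l)) (toTorus x) * dilMult d φ κ (toTorus x)) with hF
  have hFc : ∀ l, Continuous (F l) := fun l => continuous_const.mul
    (((mFourier _).continuous.comp continuous_toTorus).mul
      ((continuous_dilMult hφ.continuousOn hκ).comp continuous_toTorus))
  have hFb : ∀ l x, ‖F l x‖ ≤ ‖f l‖ * S := fun l x => by
    simp only [hF, norm_mul]
    refine mul_le_mul_of_nonneg_left ?_ (norm_nonneg _)
    exact (mul_le_of_le_one_left (norm_nonneg _) (norm_mFourier_apply_le _ _)).trans
      (hS _ (mul_nonneg hκ.le (Real.sqrt_nonneg _)))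
  have hFi : ∀ l, IntegrableOn (F l) (torusBox d) := fun l =>
    Measure.integrableOn_of_bounded volume_torusBox_lt_top.ne (hFc l).aestronglyMeasurable
      (Filter.Eventually.of_forall (hFb l))
  have hsum : Summable fun l => ∫ x in torusBox d, ‖F l x‖ := by
    refine Summable.of_nonneg_of_le (fun l => integral_nonneg fun _ => norm_nonneg _) (fun l => ?_)
      (hf.mul_right (S * volume.real (torusBox d)))
    refine (integral_mono (hFi l).norm (integrableOn_const volume_torusBox_lt_top.ne)
      (hFb l)).trans_eq ?_
    simp
    ring
  have hmain := (hasSum_integral_of_summable_integral_norm hFi hsum).tsum_eq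
  unfold MpieceZ latConv
  rw [← setIntegral_congr_set torusBox_ae_eq_Td]
  simp_rw [latKernel_eq_integral, ← integral_const_mul]
  refine Eq.trans ?_ hmain.symm
  refine integral_congr_ae (Filter.Eventually.of_forall fun x => ?_)
  simp only [hF, Ftd]
  rw [dilMult_toTorus, mul_assoc, ← tsum_mul_right, ← tsum_mul_left]
  refine tsum_congr fun l => ?_
  rw [mFourier_toTorus, mul_assoc, ← Complex.exp_add, mul_left_comm, mul_comm (φ _)]
  congr 3
  simp only [Pi.neg_apply, Pi.sub_apply]
  push_cast
  simp only [neg_sub, sub_mul, Finset.sum_sub_distrib]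
  ring

end convolution

section tails

variable {d : ℕ}

/-- The lattice points all of whose coordinates are smaller than `2 ^ r` in absolute value. -/
noncomputable def latBox (d r : ℕ) : Finset (Fin d → ℤ) := Fintype.piFinset fun _ => Finset.Ioo (-2 ^ r) (2 ^ r)

lemma mem_latBox {r : ℕ} {n : Fin d → ℤ} : n ∈ latBox d r ↔ ∀ i, |n i| < 2 ^ r := by
  simp [latBox, abs_lt]

lemma card_latBox_le (d r : ℕ) : ((latBox d r).card : ℝ) ≤ (2 ^ (r + 1)) ^ d := by
  have : (latBox d r).card ≤ (2 ^ (r + 1)) ^ d := by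
    rw [latBox, Fintype.card_piFinset, Finset.prod_const, Finset.card_univ, Fintype.card_fin]
    refine Nat.pow_le_pow_left ?_ d
    rw [Int.card_Ioo, Int.toNat_le]
    push_cast
    rw [pow_succ]
    linarith
  exact_mod_cast this

lemma latBox_mono {r s : ℕ} (h : r ≤ s) : latBox d r ⊆ latBox d s := fun n hn =>
  mem_latBox.2 fun i => (mem_latBox.1 hn i).trans_le (pow_le_pow_right₀ (by norm_num) h)

lemma exists_mem_latBox (n : Fin d → ℤ) : ∃ r, n ∈ latBox d r := by
  refine ⟨∑ i, (n i).natAbs, mem_latBox.2 fun i => ?_⟩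
  rw [Int.abs_eq_natAbs]
  have h1 : (n i).natAbs ≤ ∑ i, (n i).natAbs :=
    Finset.single_le_sum (f := fun i => (n i).natAbs) (fun _ _ => Nat.zero_le _) (Finset.mem_univ i)
  have h2 := h1.trans_lt Nat.lt_two_pow_self
  exact_mod_cast h2

lemma sum_le_sqrt_of_sum_sq_le {ι : Type*} (T : Finset ι) (g : ι → ℝ≥0∞) {N M : ℝ}
    (hN : (T.card : ℝ) ≤ N) (hM : ∑ n ∈ T, g n ^ 2 ≤ ENNReal.ofReal M) :
    ∑ n ∈ T, g n ≤ ENNReal.ofReal √(N * M) := by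
  have h := ENNReal.rpow_sum_le_const_mul_sum_rpow T g (p := 2) (by norm_num)
  norm_num at h
  have h0 : (0 : ℝ) ≤ N := (Nat.cast_nonneg _).trans hN
  rw [← ENNReal.pow_le_pow_left_iff two_ne_zero, ← ENNReal.ofReal_pow (Real.sqrt_nonneg _)]
  refine h.trans ((mul_le_mul' (b := ENNReal.ofReal N) ?_ hM).trans ?_)
  · rw [← ENNReal.ofReal_natCast]
    exact ENNReal.ofReal_le_ofReal hN
  · rw [← ENNReal.ofReal_mul h0]
    refine ENNReal.ofReal_le_ofReal ?_
    rcases le_or_gt 0 M with hM0 | hM0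
    · rw [Real.sq_sqrt (by positivity)]
    · exact (mul_nonpos_of_nonneg_of_nonpos h0 hM0.le).trans (sq_nonneg _)

lemma sum_biUnion_le_sum {ι α : Type*} [DecidableEq α] (S : Finset ι) (T : ι → Finset α)
    (g : α → ℝ≥0∞) : ∑ n ∈ S.biUnion T, g n ≤ ∑ i ∈ S, ∑ n ∈ T i, g n := by
  classical
  induction S using Finset.induction_on with
  | empty => simp
  | insert i S hi ih =>
    rw [Finset.biUnion_insert, Finset.sum_insert hi]
    refine le_trans ?_ (add_le_add_right ih _)
    rw [← Finset.sum_union_inter]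
    exact le_self_add

lemma one_le_norm_exp_sub_one {x : ℝ} (h1 : 1 / 4 ≤ |x|) (h2 : |x| ≤ 1 / 2) :
    1 ≤ ‖Complex.exp (Complex.I * ((2 * π * x : ℝ) : ℂ)) - 1‖ := by
  rw [Complex.norm_exp_I_mul_ofReal_sub_one, norm_mul, Real.norm_of_nonneg zero_le_two,
    show 2 * π * x / 2 = π * x by ring, Real.norm_eq_abs]
  have h3 : |sin (π * x)| = |sin (π * |x|)| := by
    rcases abs_choice x with h | h <;> rw [h]
    rw [mul_neg, Real.sin_neg, abs_neg]
  have h4 := Real.mul_le_sin (x := π * |x|) (by positivity) (by nlinarith [Real.pi_pos])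
  have h5 : 2 / π * (π * |x|) = 2 * |x| := by field_simp
  rw [h3]
  linarith [le_abs_self (sin (π * |x|))]

variable {K : (Fin d → ℤ) → ℂ} {s : ℕ} {C κ : ℝ}

lemma sum_shell_le (hκ : 0 < κ) (hC : 0 ≤ C)
    (hK : ∀ h : ℝ, 0 < h → ∀ i : Fin d,
      ∑' n, (‖Complex.exp (Complex.I * ((2 * π * h * n i : ℝ) : ℂ)) - 1‖ₑ ^ s * ‖K n‖ₑ) ^ 2 ≤
        ENNReal.ofReal (C * κ ^ 2 * h ^ (d + 2))) (r : ℕ) :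
    ∑ n ∈ latBox d (r + 1) \ latBox d r, ‖K n‖ₑ ≤
      ENNReal.ofReal (d * (√C * κ / 2 ^ (r + 2))) := by
  classical
  set T : Fin d → Finset (Fin d → ℤ) := fun i => {n ∈ latBox d (r + 1) | 2 ^ r ≤ |n i|} with hT
  have hsub : latBox d (r + 1) \ latBox d r ⊆ Finset.univ.biUnion T := by
    intro n hn
    rw [Finset.mem_sdiff] at hn
    have := hn.2
    rw [mem_latBox] at this
    push Not at this
    obtain ⟨i, hi⟩ := this
    exact Finset.mem_biUnion.2 ⟨i, Finset.mem_univ _, Finset.mem_filter.2 ⟨hn.1, hi⟩⟩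
  have hTi : ∀ i, ∑ n ∈ T i, ‖K n‖ₑ ≤ ENNReal.ofReal (√C * κ / 2 ^ (r + 2)) := by
    intro i
    have hcard : ((T i).card : ℝ) ≤ (2 ^ (r + 2)) ^ d :=
      (Nat.cast_le.2 (Finset.card_le_card (Finset.filter_subset _ _))).trans
        (card_latBox_le d (r + 1))
    have hM : ∑ n ∈ T i, ‖K n‖ₑ ^ 2 ≤ ENNReal.ofReal (C * κ ^ 2 * (1 / 2 ^ (r + 2)) ^ (d + 2)) := by
      refine le_trans (Finset.sum_le_sum fun n hn => ?_)
        ((ENNReal.sum_le_tsum (T i)).trans (hK (1 / 2 ^ (r + 2)) (by positivity) i))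
      refine pow_le_pow_left' (le_mul_of_one_le_left' (one_le_pow₀ ?_)) 2
      rw [hT, Finset.mem_filter, mem_latBox] at hn
      have h1 : (2 : ℝ) ^ r ≤ |(n i : ℝ)| := by exact_mod_cast hn.2
      have h2 : |(n i : ℝ)| ≤ 2 ^ (r + 1) := by exact_mod_cast (hn.1 i).le
      have h3 : |1 / 2 ^ (r + 2) * (n i : ℝ)| = |(n i : ℝ)| / 2 ^ (r + 2) := by
        rw [abs_mul, abs_of_pos (by positivity)]; ring
      rw [← ofReal_norm, ← ENNReal.ofReal_one, mul_assoc (2 * π)]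
      refine ENNReal.ofReal_le_ofReal (one_le_norm_exp_sub_one ?_ ?_)
      · rw [h3, le_div_iff₀ (by positivity)]
        refine le_trans (le_of_eq ?_) h1
        ring
      · rw [h3, div_le_iff₀ (by positivity)]
        refine h2.trans (le_of_eq ?_)
        ring
    refine (sum_le_sqrt_of_sum_sq_le _ _ hcard hM).trans (ENNReal.ofReal_le_ofReal (le_of_eq ?_))
    rw [Real.sqrt_eq_iff_mul_self_eq (by positivity) (by positivity)]
    rw [pow_add _ d 2, one_div, inv_pow]
    field_simp
    rw [Real.sq_sqrt hC]
  calc ∑ n ∈ latBox d (r + 1) \ latBox d r, ‖K n‖ₑ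
      ≤ ∑ n ∈ Finset.univ.biUnion T, ‖K n‖ₑ := Finset.sum_le_sum_of_subset hsub
    _ ≤ ∑ i, ∑ n ∈ T i, ‖K n‖ₑ := sum_biUnion_le_sum _ _ _
    _ ≤ ∑ _i : Fin d, ENNReal.ofReal (√C * κ / 2 ^ (r + 2)) := Finset.sum_le_sum fun i _ => hTi i
    _ = _ := by
      rw [Finset.sum_const, Finset.card_univ, Fintype.card_fin, nsmul_eq_mul,
        ENNReal.ofReal_mul (Nat.cast_nonneg _), ENNReal.ofReal_natCast]

lemma tsum_notMem_latBox_le (hκ : 0 < κ) (hC : 0 ≤ C)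
    (hK : ∀ h : ℝ, 0 < h → ∀ i : Fin d,
      ∑' n, (‖Complex.exp (Complex.I * ((2 * π * h * n i : ℝ) : ℂ)) - 1‖ₑ ^ s * ‖K n‖ₑ) ^ 2 ≤
        ENNReal.ofReal (C * κ ^ 2 * h ^ (d + 2))) (r : ℕ) :
    ∑' n, (if n ∈ latBox d r then 0 else ‖K n‖ₑ) ≤ ENNReal.ofReal (d * √C * κ / 2 ^ r) := by
  have hpt : ∀ n, (if n ∈ latBox d r then 0 else ‖K n‖ₑ) ≤
      ∑' j : ℕ, if n ∈ latBox d (r + j + 1) \ latBox d (r + j) then ‖K n‖ₑ else 0 := by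
    intro n
    split_ifs with hn
    · exact zero_le
    · have hex := exists_mem_latBox n
      classical
      set t := Nat.find hex with ht
      have htm : n ∈ latBox d t := Nat.find_spec hex
      have hrt : r < t := by
        by_contra h
        exact hn (latBox_mono (not_lt.1 h) htm)
      refine le_trans ?_ (ENNReal.le_tsum (t - 1 - r))
      rw [if_pos]
      rw [Finset.mem_sdiff, show r + (t - 1 - r) + 1 = t by omega]
      exact ⟨htm, Nat.find_min hex (by omega)⟩
  refine (ENNReal.tsum_le_tsum hpt).trans ?_
  rw [ENNReal.tsum_comm]
  have hj : ∀ j : ℕ, ∑' n, (if n ∈ latBox d (r + j + 1) \ latBox d (r + j) then ‖K n‖ₑ else 0) ≤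
      ENNReal.ofReal ((d * √C * κ / 2 ^ r) * (1 / 2 / 2 ^ j)) := by
    intro j
    rw [tsum_eq_sum (s := latBox d (r + j + 1) \ latBox d (r + j)) fun n hn => if_neg hn,
      Finset.sum_congr rfl fun n hn => if_pos hn]
    refine (sum_shell_le hκ hC hK (r + j)).trans (ENNReal.ofReal_le_ofReal ?_)
    have : d * (√C * κ / 2 ^ (r + j + 2)) = (d * √C * κ / 2 ^ r) * (1 / 2 / 2 ^ j) * (1 / 2) := by
      rw [pow_add, pow_add]; field_simp
    rw [this]
    exact mul_le_of_le_one_right (by positivity) (by norm_num)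
  refine (ENNReal.tsum_le_tsum hj).trans ?_
  have hs : HasSum (fun j : ℕ => (d * √C * κ / 2 ^ r) * (1 / 2 / 2 ^ j))
      (d * √C * κ / 2 ^ r * 1) := (hasSum_geometric_two' 1).mul_left _
  rw [← ENNReal.ofReal_tsum_of_nonneg (fun j => by positivity) hs.summable, hs.tsum_eq, mul_one]

end tails

section kernelBounds

variable {d : ℕ} {φ : ℝ → ℂ}

lemma exists_tsum_notMem_latBox_le (hφ : ContDiffOn ℝ (d / 2 + 4 : ℕ) φ (Set.Ici 0))
    (hφc : HasCompactSupport φ) :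
    ∃ D : ℝ, 0 ≤ D ∧ ∀ κ : ℝ, 0 < κ → ∀ r : ℕ,
      ∑' n, (if n ∈ latBox d r then 0 else ‖latKernel d φ κ n‖ₑ) ≤
        ENNReal.ofReal (D * κ / 2 ^ r) := by
  obtain ⟨C, hC, h⟩ := tsum_diff_latKernel_sq_le (d := d) (s := d / 2 + 2) (by omega) (by omega)
    (by omega) hφ hφc
  exact ⟨d * √C, by positivity, fun κ hκ r => tsum_notMem_latBox_le hκ hC (h κ hκ) r⟩

lemma tsum_le_sum_add_tsum_notMem {α : Type*} [DecidableEq α] (T : Finset α) (g : α → ℝ≥0∞) :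
    ∑' n, g n ≤ ∑ n ∈ T, g n + ∑' n, (if n ∈ T then 0 else g n) := by
  have h : ∑ n ∈ T, g n = ∑' n, (if n ∈ T then g n else 0) := by
    rw [tsum_eq_sum (s := T) fun n hn => if_neg hn]
    exact (Finset.sum_congr rfl fun n hn => if_pos hn).symm
  rw [h, ← ENNReal.tsum_add]
  refine ENNReal.tsum_le_tsum fun n => ?_
  split_ifs <;> simp

lemma exists_tsum_latKernel_le (hφ : ContDiffOn ℝ (d / 2 + 4 : ℕ) φ (Set.Ici 0))
    (hφc : HasCompactSupport φ) :
    ∃ A : ℝ, ∀ k : ℤ, ∑' n, ‖latKernel d φ (2 ^ (-k)) n‖ₑ ≤ ENNReal.ofReal A := by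
  obtain ⟨D, hD, hT⟩ := exists_tsum_notMem_latBox_le hφ hφc
  obtain ⟨S, hS0, hS⟩ := exists_forall_norm_le_of_hasCompactSupport hφ hφc
  obtain ⟨A, hA0, hA⟩ := exists_forall_eq_zero hφc
  refine ⟨max S √(S ^ 2 * (4 * A) ^ d) + D, fun k => ?_⟩
  rw [ENNReal.ofReal_add (le_max_of_le_left hS0) hD]
  have hκ : (0 : ℝ) < 2 ^ (-k) := by positivity
  rcases le_or_gt 0 k with hk | hk
  · refine (tsum_le_sum_add_tsum_notMem (latBox d 0) _).trans (add_le_add ?_ ?_)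
    · have : latBox d 0 = {0} := by
        ext n
        simp only [mem_latBox, Finset.mem_singleton, funext_iff, Pi.zero_apply, pow_zero,
          Int.abs_lt_one_iff]
      rw [this, Finset.sum_singleton, ← ofReal_norm]
      exact ENNReal.ofReal_le_ofReal ((norm_latKernel_le hκ hS 0).trans (le_max_left _ _))
    · refine (hT _ hκ 0).trans (ENNReal.ofReal_le_ofReal ?_)
      rw [pow_zero, div_one]
      exact mul_le_of_le_one_right hD (zpow_le_one_of_nonpos₀ one_le_two (by omega))
  · obtain ⟨j, rfl⟩ : ∃ j : ℕ, k = -(j : ℤ) := ⟨k.natAbs, by omega⟩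
    rw [neg_neg, zpow_natCast] at hκ ⊢
    refine (tsum_le_sum_add_tsum_notMem (latBox d j) _).trans (add_le_add ?_ ?_)
    · refine (sum_le_sqrt_of_sum_sq_le _ _ (card_latBox_le d j) ((ENNReal.sum_le_tsum _).trans
        (tsum_latKernel_sq_le hκ hA0 hφ.continuousOn hS hA))).trans (ENNReal.ofReal_le_ofReal ?_)
      refine le_trans (le_of_eq ?_) (le_max_right _ _)
      congr 1
      rw [mul_left_comm, ← mul_pow]
      congr 2
      field_simp
      ring
    · refine (hT _ hκ j).trans (ENNReal.ofReal_le_ofReal (le_of_eq ?_))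
      field_simp

lemma abs_sub_le_of_coarse_eq {q : ℕ} {x y : Fin d → ℤ} (h : coarse q x = coarse q y) (i : Fin d) :
    |x i - y i| < 2 ^ q := by
  have hi : x i / 2 ^ q = y i / 2 ^ q := congrFun h i
  have hq : (0 : ℤ) < 2 ^ q := by positivity
  have hx := Int.emod_add_mul_ediv (x i) (2 ^ q)
  have hy := Int.emod_add_mul_ediv (y i) (2 ^ q)
  have h1 := Int.emod_nonneg (x i) hq.ne'
  have h2 := Int.emod_lt_of_pos (x i) hq
  have h3 := Int.emod_nonneg (y i) hq.ne'
  have h4 := Int.emod_lt_of_pos (y i) hq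
  rw [hi] at hx
  rw [abs_lt]
  constructor <;> linarith

lemma near_of_sub_mem_latBox {q : ℕ} {n y : Fin d → ℤ} (h : n - y ∈ latBox d (q + 1)) :
    Near q n y := by
  intro i
  have hi := mem_latBox.1 h i
  rw [Pi.sub_apply, pow_succ, abs_lt] at hi
  have hq : (0 : ℤ) < 2 ^ q := by positivity
  have hx := Int.emod_add_mul_ediv (n i) (2 ^ q)
  have hy := Int.emod_add_mul_ediv (y i) (2 ^ q)
  have h1 := Int.emod_nonneg (n i) hq.ne'
  have h2 := Int.emod_lt_of_pos (n i) hq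
  have h3 := Int.emod_nonneg (y i) hq.ne'
  have h4 := Int.emod_lt_of_pos (y i) hq
  rw [abs_le]
  constructor <;> nlinarith

lemma sub_mem_latBox_succ {q r : ℕ} (hqr : q ≤ r) {n x y : Fin d → ℤ}
    (hxy : coarse q x = coarse q y) (h : n - x ∈ latBox d r) : n - y ∈ latBox d (r + 1) := by
  refine mem_latBox.2 fun i => ?_
  have h1 := mem_latBox.1 h i
  have h2 := abs_sub_le_of_coarse_eq hxy i
  have h3 : (2 : ℤ) ^ q ≤ 2 ^ r := pow_le_pow_right₀ (by norm_num) hqr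
  rw [Pi.sub_apply] at h1 ⊢
  have h4 := abs_add_le (n i - x i) (x i - y i)
  rw [sub_add_sub_cancel] at h4
  rw [pow_succ]
  linarith

/-- The contribution of the points far away from both `x` and `y`. -/
lemma tsum_far_le {K : (Fin d → ℤ) → ℂ} {r q : ℕ} {M : ℝ≥0∞} (hqr : q ≤ r) {x y : Fin d → ℤ}
    (hxy : coarse q x = coarse q y) (hK : ∑' n, (if n ∈ latBox d r then 0 else ‖K n‖ₑ) ≤ M) :
    ∑' n, (if n - y ∈ latBox d (r + 1) then 0 else ‖K (n - y) - K (n - x)‖ₑ) ≤ 2 * M := by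
  set g : (Fin d → ℤ) → ℝ≥0∞ := fun n => if n ∈ latBox d r then 0 else ‖K n‖ₑ with hg
  have hpt : ∀ n, (if n - y ∈ latBox d (r + 1) then 0 else ‖K (n - y) - K (n - x)‖ₑ) ≤
      g (n - y) + g (n - x) := by
    intro n
    split_ifs with h
    · exact zero_le
    · have h1 : n - y ∉ latBox d r := fun h' => h (latBox_mono r.le_succ h')
      have h2 : n - x ∉ latBox d r := fun h' => h (sub_mem_latBox_succ hqr hxy h')
      simp only [hg, if_neg h1, if_neg h2]
      exact enorm_sub_le
  refine (ENNReal.tsum_le_tsum hpt).trans ?_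
  have e : ∀ z : Fin d → ℤ, ∑' n, g (n - z) = ∑' n, g n := fun z => (Equiv.subRight z).tsum_eq g
  rw [ENNReal.tsum_add, e, e, two_mul]
  exact add_le_add hK hK

lemma tsum_geometric_div_ne_top {m : ℕ} (hm : 0 < m) :
    ∑' i : ℕ, ENNReal.ofReal (1 / 2 ^ (i / m)) ≠ ∞ := by
  have : NeZero m := ⟨hm.ne'⟩
  rw [← (Nat.divModEquiv m).symm.tsum_eq, ENNReal.tsum_prod']
  have h : ∀ (a : ℕ) (b : Fin m), ((Nat.divModEquiv m).symm (a, b)) / m = a := by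
    intro a b
    have := congrArg Prod.fst ((Nat.divModEquiv m).apply_symm_apply (a, b))
    simpa using this
  simp_rw [h]
  simp only [tsum_fintype, Finset.sum_const, Finset.card_univ, Fintype.card_fin, nsmul_eq_mul]
  rw [ENNReal.tsum_mul_left]
  refine ENNReal.mul_ne_top (ENNReal.natCast_ne_top m) ?_
  have hs : Summable fun a : ℕ => (1 : ℝ) / 2 ^ a := by
    simpa using summable_geometric_two
  rw [← ENNReal.ofReal_tsum_of_nonneg (fun a => by positivity) hs]
  exact ENNReal.ofReal_ne_top

end kernelBounds

section hormander

variable {d : ℕ} {φ : ℝ → ℂ}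

/-- Kernel differences at frequencies much smaller than the reciprocal of the displacement. -/
lemma exists_tsum_latKernel_sub_le (hd : 1 ≤ d) (hφ : ContDiffOn ℝ (d / 2 + 4 : ℕ) φ (Set.Ici 0))
    (hφc : HasCompactSupport φ) :
    ∃ E : ℝ, 0 ≤ E ∧ ∀ (q i : ℕ) (x y : Fin d → ℤ), coarse q x = coarse q y →
      ∑' n, ‖latKernel d φ (2 ^ (q + i)) (n - y) - latKernel d φ (2 ^ (q + i)) (n - x)‖ₑ ≤
        ENNReal.ofReal (E * (1 / 2 ^ (i / (2 * d)))) := by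
  obtain ⟨D, hD, hT⟩ := exists_tsum_notMem_latBox_le hφ hφc
  obtain ⟨S, hS0, hS⟩ := exists_forall_norm_le_of_hasCompactSupport hφ hφc
  obtain ⟨A, hA0, hA⟩ := exists_forall_eq_zero hφc
  set W : ℝ := 2 * π * d * A * S with hW
  set V : ℝ := W ^ 2 * (8 * A) ^ d with hV
  have hV0 : 0 ≤ V := by positivity
  refine ⟨√V + 2 * D, by positivity, fun q i x y hxy => ?_⟩
  set a := i / (2 * d) with ha
  set K := latKernel d φ (2 ^ (q + i)) with hK
  have hκ : (0 : ℝ) < 2 ^ (q + i) := by positivity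
  have hfar : ∑' n, (if n - y ∈ latBox d (q + i + a + 1) then 0 else
      ‖K (n - y) - K (n - x)‖ₑ) ≤ ENNReal.ofReal (2 * D * (1 / 2 ^ a)) := by
    refine (tsum_far_le (by rw [add_assoc]; exact Nat.le_add_right q _) hxy
      (hT _ hκ (q + i + a))).trans (le_of_eq ?_)
    rw [← ENNReal.ofReal_ofNat 2, ← ENNReal.ofReal_mul zero_le_two]
    congr 1
    rw [pow_add _ (q + i) a]
    field_simp
  set T := (latBox d (q + i + a + 1)).image (· + y) with hTdef
  have hmem : ∀ n, n ∈ T ↔ n - y ∈ latBox d (q + i + a + 1) := by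
    intro n
    simp only [hTdef, Finset.mem_image]
    constructor
    · rintro ⟨m, hm, rfl⟩
      simpa using hm
    · exact fun h => ⟨_, h, sub_add_cancel n y⟩
  have hcard : (T.card : ℝ) ≤ (2 ^ (q + i + a + 1 + 1)) ^ d :=
    (Nat.cast_le.2 Finset.card_image_le).trans (card_latBox_le d _)
  have hL : ∀ j, |(x j : ℝ) - y j| ≤ 2 ^ q := fun j => by
    exact_mod_cast (abs_sub_le_of_coarse_eq hxy j).le
  have hnear : ∑ n ∈ T, ‖K (n - y) - K (n - x)‖ₑ ≤ ENNReal.ofReal (√V * (1 / 2 ^ a)) := by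
    refine (sum_le_sqrt_of_sum_sq_le T _ hcard ((ENNReal.sum_le_tsum T).trans
      (tsum_latKernel_sub_sq_le hκ hA0 hφ.continuousOn hS hA (by positivity) x y hL))).trans
      (ENNReal.ofReal_le_ofReal ?_)
    have e1 : ((2 : ℝ) ^ (q + i + a + 1 + 1)) ^ d *
        ((2 * π * d * 2 ^ q * (A / 2 ^ (q + i))) ^ 2 * S ^ 2 * (2 * A / 2 ^ (q + i)) ^ d) =
        V * ((2 ^ a) ^ d / (2 ^ i) ^ 2) := by
      have e2 : ((2 : ℝ) ^ (q + i + a + 1 + 1)) ^ d * (2 * A / 2 ^ (q + i)) ^ d =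
          (8 * A) ^ d * (2 ^ a) ^ d := by
        rw [← mul_pow, ← mul_pow]
        congr 1
        rw [pow_add, pow_add, pow_add _ (q + i) a]
        field_simp
        ring
      have e3 : 2 * π * d * 2 ^ q * (A / 2 ^ (q + i)) * S = W / 2 ^ i := by
        rw [hW, pow_add]
        field_simp
      calc _ = (2 * π * d * 2 ^ q * (A / 2 ^ (q + i)) * S) ^ 2 *
            (((2 : ℝ) ^ (q + i + a + 1 + 1)) ^ d * (2 * A / 2 ^ (q + i)) ^ d) := by ring
        _ = _ := by rw [e2, e3, hV]; ring
    have hexp : a * d + 2 * a ≤ 2 * i := by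
      have h1 : a * (2 * d) ≤ i := Nat.div_mul_le_self i (2 * d)
      nlinarith [Nat.zero_le a]
    have e5 : ((2 : ℝ) ^ a) ^ d / (2 ^ i) ^ 2 ≤ (1 / 2 ^ a) ^ 2 := by
      rw [div_pow, one_pow, div_le_div_iff₀ (by positivity) (by positivity), one_mul, ← pow_mul,
        ← pow_mul, ← pow_mul, ← pow_add]
      exact pow_le_pow_right₀ one_le_two (by linarith)
    rw [e1]
    refine (Real.sqrt_le_sqrt (mul_le_mul_of_nonneg_left e5 hV0)).trans (le_of_eq ?_)
    rw [Real.sqrt_mul hV0, Real.sqrt_sq (by positivity)]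
  refine (tsum_le_sum_add_tsum_notMem T _).trans ?_
  rw [add_mul, ENNReal.ofReal_add (by positivity) (by positivity)]
  simp_rw [hmem]
  exact add_le_add hnear hfar

open Classical in
lemma exists_maxHormander (hd : 1 ≤ d) (hφ : ContDiffOn ℝ (d / 2 + 4 : ℕ) φ (Set.Ici 0))
    (hφc : HasCompactSupport φ) :
    ∃ B : ℝ≥0∞, B ≠ ∞ ∧ MaxHormander (fun k : ℤ => latKernel d φ (2 ^ (-k))) B := by
  obtain ⟨D, hD, hT⟩ := exists_tsum_notMem_latBox_le hφ hφc
  obtain ⟨E, hE, hsub⟩ := exists_tsum_latKernel_sub_le hd hφ hφc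
  set b : ℕ → ℝ≥0∞ := fun l => ENNReal.ofReal (2 * D) * ENNReal.ofReal (1 / 2 ^ (l / 1)) with hb
  set c : ℕ → ℝ≥0∞ := fun i => ENNReal.ofReal E * ENNReal.ofReal (1 / 2 ^ (i / (2 * d))) with hc
  refine ⟨∑' l, b l + ∑' i, c i, ?_, ?_⟩
  · simp only [hb, hc, ENNReal.tsum_mul_left]
    exact ENNReal.add_ne_top.2
      ⟨ENNReal.mul_ne_top ENNReal.ofReal_ne_top (tsum_geometric_div_ne_top one_pos),
        ENNReal.mul_ne_top ENNReal.ofReal_ne_top (tsum_geometric_div_ne_top (by omega))⟩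
  intro q y x hxy
  set G : ℤ → (Fin d → ℤ) → ℝ≥0∞ := fun k n => if Near q n y then 0 else
    ‖latKernel d φ (2 ^ (-k)) (n - y) - latKernel d φ (2 ^ (-k)) (n - x)‖ₑ with hG
  have hfine : ∀ l : ℕ, ∑' n, G (l - q) n ≤ b l := by
    intro l
    have hκ : (0 : ℝ) < 2 ^ (-((l : ℤ) - q)) := by positivity
    refine le_trans (ENNReal.tsum_le_tsum fun n => ?_)
      ((tsum_far_le le_rfl hxy (hT _ hκ q)).trans (le_of_eq ?_))
    · simp only [hG]
      split_ifs with h1 h2 h2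
      · exact le_rfl
      · exact zero_le
      · exact absurd (near_of_sub_mem_latBox h2) h1
      · exact le_rfl
    · simp only [hb]
      rw [← ENNReal.ofReal_ofNat 2, ← ENNReal.ofReal_mul zero_le_two,
        ← ENNReal.ofReal_mul (by positivity), Nat.div_one, neg_sub, zpow_sub₀ two_ne_zero,
        zpow_natCast, zpow_natCast]
      congr 1
      field_simp
  have hcoarse : ∀ i : ℕ, ∑' n, G (-(q : ℤ) - i) n ≤ c i := by
    intro i
    simp only [hc]
    rw [← ENNReal.ofReal_mul hE]
    refine le_trans (ENNReal.tsum_le_tsum fun n => ?_) (hsub q i x y hxy)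
    have e : (2 : ℝ) ^ (-(-(q : ℤ) - i)) = 2 ^ (q + i) := by
      rw [← zpow_natCast]
      congr 1
      push_cast
      ring
    simp only [hG, e]
    split_ifs
    · exact zero_le
    · exact le_rfl
  have hpt : ∀ n, (if Near q n y then 0 else ⨆ k : ℤ,
      ‖latKernel d φ (2 ^ (-k)) (n - y) - latKernel d φ (2 ^ (-k)) (n - x)‖ₑ) ≤
      ∑' l : ℕ, G (l - q) n + ∑' i : ℕ, G (-(q : ℤ) - i) n := by
    intro n
    by_cases h : Near q n y
    · rw [if_pos h]; exact zero_le
    · rw [if_neg h]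
      refine iSup_le fun k => ?_
      have hk : ‖latKernel d φ (2 ^ (-k)) (n - y) - latKernel d φ (2 ^ (-k)) (n - x)‖ₑ = G k n := by
        simp only [hG, if_neg h]
      rw [hk]
      rcases le_or_gt 0 (k + q) with h0 | h0
      · have := ENNReal.le_tsum (f := fun l : ℕ => G (l - q) n) (k + q).toNat
        rw [show (((k + q).toNat : ℤ) - q) = k by omega] at this
        exact this.trans le_self_add
      · have := ENNReal.le_tsum (f := fun i : ℕ => G (-(q : ℤ) - i) n) (-(k + q)).toNat
        rw [show (-(q : ℤ) - ((-(k + q)).toNat : ℤ)) = k by omega] at this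
        exact this.trans le_add_self
  refine (ENNReal.tsum_le_tsum hpt).trans ?_
  rw [ENNReal.tsum_add, ENNReal.tsum_comm,
    ENNReal.tsum_comm (f := fun n (i : ℕ) => G (-(q : ℤ) - i) n)]
  exact add_le_add (ENNReal.tsum_le_tsum hfine) (ENNReal.tsum_le_tsum hcoarse)

end hormander

/-- **Maximal function estimate for the discrete Laplacian on `ℤ^d`**
(the paper's Proposition 2.3 for `L = (-Δ_{ℤ^d})^{1/2}`, with `ρ = ⌊d/2⌋ + 1` and
`φ ∈ C^{⌊d/2⌋+4}` compactly supported): for `1 < p < ∞`,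
`‖sup_k |M_k f|‖_{ℓ^p} ≤ C ‖f‖_{ℓ^p}` for `f ∈ ℓ¹(ℤ^d)`. -/
theorem stmt17 (d : ℕ) (hd : 1 ≤ d)
    (φ : ℝ → ℂ) (hφ : ContDiffOn ℝ (d / 2 + 4 : ℕ) φ (Set.Ici 0))
    (hφc : HasCompactSupport φ)
    (p : ℝ) (hp : 1 < p) :
    ∃ C : ℝ, 0 < C ∧
      ∀ f : (Fin d → ℤ) → ℂ, Summable (fun n => ‖f n‖) →
        (∑' n : Fin d → ℤ, (⨆ k : ℤ, (‖MpieceZ d φ k f n‖₊ : ℝ≥0∞)) ^ p) ^ (1 / p)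
          ≤ ENNReal.ofReal C * lpN d p f := by
  obtain ⟨A, hA⟩ := exists_tsum_latKernel_le hφ hφc
  obtain ⟨B, hBtop, hB⟩ := exists_maxHormander hd hφ hφc
  obtain ⟨C, hC, h⟩ := exists_latMax_bound hd ENNReal.ofReal_ne_top hA hBtop hB hp
  refine ⟨C, hC, fun f hf => ?_⟩
  have hf' : ∑' n, ‖f n‖ₑ ≠ ∞ := by
    simp_rw [← ofReal_norm]
    exact hf.tsum_ofReal_ne_top
  simp_rw [MpieceZ_eq_latConv hφ hφc _ hf]
  exact h f hf'
end

section
/- Let s > 0 be real and let φ : [0,∞) → ℂ be a C^∞ function with φ(t) = 1 for t ∈ [0, 1/4] and φ(t) = 0 for t ≥ 1/2. Define m : ℝ² ∖ {0} → ℂ by m(ξ₁,ξ₂) := (|ξ₁+ξ₂| / |ξ₁|)^{2s} · φ(|ξ₂|/|ξ₁|) when ξ₁ ≠ 0, and m(ξ₁,ξ₂) := 0 when ξ₁ = 0. Then m is C^∞ on ℝ² ∖ {0} and for every multi-index α ∈ ℕ² one has sup_{ξ ∈ ℝ²∖{0}} |ξ|^{|α|} |∂^α m(ξ)| < ∞;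 that is, m satisfies the Mikhlin–Hörmander condition on ℝ² of every order. -/
open Real

/-- First partial derivative of a function of two real variables. -/
noncomputable def pd1 (m : ℝ → ℝ → ℂ) : ℝ → ℝ → ℂ := fun x y => deriv (fun t => m t y) x

/-- Second partial derivative of a function of two real variables. -/
noncomputable def pd2 (m : ℝ → ℝ → ℂ) : ℝ → ℝ → ℂ := fun x y => deriv (fun t => m x t) y

/-- The mixed partial derivative `∂₁^a ∂₂^b m`. -/
noncomputable def mpd (a b : ℕ) (m : ℝ → ℝ → ℂ) : ℝ → ℝ → ℂ :=
  pd1^[a] (pd2^[b] m)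

/-- The paraproduct symbol `m(ξ₁,ξ₂) = (|ξ₁+ξ₂|/|ξ₁|)^{2s} φ(|ξ₂|/|ξ₁|)` (set to `0` when
`ξ₁ = 0`) used in the proof of the fractional Leibniz rules. -/
noncomputable def mSymb (s : ℝ) (φ : ℝ → ℂ) (x y : ℝ) : ℂ :=
  if x = 0 then 0
  else (((|x + y| / |x|) ^ (2 * s) : ℝ) : ℂ) * φ (|y| / |x|)

/-- A function of two real variables that is smooth away from the origin and positively
homogeneous of degree `-k`. -/
structure SmoothHomogeneous (k : ℕ) (f : ℝ → ℝ → ℂ) : Prop where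
  contDiffOn : ContDiffOn ℝ (⊤ : ℕ∞) (fun q : ℝ × ℝ => f q.1 q.2) {q : ℝ × ℝ | q ≠ 0}
  homogeneous : ∀ t : ℝ, 0 < t → ∀ x y : ℝ, (t : ℂ) ^ k * f (t * x) (t * y) = f x y

lemma contDiffOn_fderiv_apply {F : ℝ × ℝ → ℂ} {U : Set (ℝ × ℝ)} (hU : IsOpen U)
    (hF : ContDiffOn ℝ (⊤ : ℕ∞) F U) (v : ℝ × ℝ) :
    ContDiffOn ℝ (⊤ : ℕ∞) (fun q => fderiv ℝ F q v) U :=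
  (hF.fderiv_of_isOpen hU (by simp)).clm_apply contDiffOn_const

namespace SmoothHomogeneous

variable {k : ℕ} {f : ℝ → ℝ → ℂ}

lemma differentiableAt (hf : SmoothHomogeneous k f) {q : ℝ × ℝ} (hq : q ≠ 0) :
    DifferentiableAt ℝ (fun q : ℝ × ℝ => f q.1 q.2) q :=
  (hf.contDiffOn.contDiffAt (isOpen_ne.mem_nhds hq)).differentiableAt (by simp)

protected lemma pd1 (hf : SmoothHomogeneous k f) : SmoothHomogeneous (k + 1) (pd1 f) where
  contDiffOn := by
    refine (contDiffOn_fderiv_apply isOpen_ne hf.contDiffOn (1, 0)).congr fun q hq => ?_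
    have h : HasDerivAt (fun t : ℝ => (t, q.2)) ((1 : ℝ), (0 : ℝ)) q.1 :=
      (hasDerivAt_id q.1).prodMk (hasDerivAt_const q.1 q.2)
    exact ((hf.differentiableAt hq).hasFDerivAt.comp_hasDerivAt q.1 h).deriv
  homogeneous t ht x y := by
    have h : (fun u => f u y) = fun u => (t : ℂ) ^ k * f (t * u) (t * y) :=
      funext fun u => (hf.homogeneous t ht u y).symm
    have h' := deriv_comp_mul_left t (fun u => f u (t * y)) x
    simp only [_root_.pd1]
    rw [h, deriv_const_mul_field, h', Complex.real_smul]
    ring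

protected lemma pd2 (hf : SmoothHomogeneous k f) : SmoothHomogeneous (k + 1) (pd2 f) where
  contDiffOn := by
    refine (contDiffOn_fderiv_apply isOpen_ne hf.contDiffOn (0, 1)).congr fun q hq => ?_
    have h : HasDerivAt (fun t : ℝ => (q.1, t)) ((0 : ℝ), (1 : ℝ)) q.2 :=
      (hasDerivAt_const q.2 q.1).prodMk (hasDerivAt_id q.2)
    exact ((hf.differentiableAt hq).hasFDerivAt.comp_hasDerivAt q.2 h).deriv
  homogeneous t ht x y := by
    have h : (fun u => f x u) = fun u => (t : ℂ) ^ k * f (t * x) (t * u) :=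
      funext fun u => (hf.homogeneous t ht x u).symm
    have h' := deriv_comp_mul_left t (fun u => f (t * x) u) y
    simp only [_root_.pd2]
    rw [h, deriv_const_mul_field, h', Complex.real_smul]
    ring

protected lemma mpd (hf : SmoothHomogeneous k f) (a b : ℕ) :
    SmoothHomogeneous (k + (a + b)) (mpd a b f) := by
  have h2 : SmoothHomogeneous (k + b) (_root_.pd2^[b] f) := by
    induction b with
    | zero => exact hf
    | succ n ih =>
      rw [Function.iterate_succ_apply']
      exact ih.pd2
  rw [add_comm a b, ← add_assoc]
  unfold _root_.mpd
  induction a with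
  | zero => exact h2
  | succ n ih =>
    rw [Function.iterate_succ_apply']
    exact ih.pd1

lemma exists_bound (hf : SmoothHomogeneous k f) :
    ∃ A : ℝ, ∀ x y : ℝ, (x, y) ≠ ((0 : ℝ), (0 : ℝ)) →
      √(x ^ 2 + y ^ 2) ^ k * ‖f x y‖ ≤ A := by
  have hK : IsCompact {q : ℝ × ℝ | q.1 ^ 2 + q.2 ^ 2 = 1} := by
    refine (isCompact_closedBall (0 : ℝ × ℝ) 1).of_isClosed_subset
      (isClosed_eq (by fun_prop) continuous_const) fun q (hq : q.1 ^ 2 + q.2 ^ 2 = 1) => ?_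
    rw [mem_closedBall_zero_iff, Prod.norm_def, max_le_iff, Real.norm_eq_abs, Real.norm_eq_abs,
      ← sq_le_one_iff_abs_le_one, ← sq_le_one_iff_abs_le_one]
    constructor <;> nlinarith [sq_nonneg q.1, sq_nonneg q.2]
  obtain ⟨A, hA⟩ := hK.exists_bound_of_continuousOn (hf.contDiffOn.continuousOn.mono
    fun q (hq : q.1 ^ 2 + q.2 ^ 2 = 1) => by rintro rfl; simp at hq)
  refine ⟨A, fun x y hxy => ?_⟩
  have hpos : 0 < x ^ 2 + y ^ 2 := by
    by_contra! h
    have hx : x = 0 := by nlinarith [sq_nonneg x, sq_nonneg y]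
    have hy : y = 0 := by nlinarith [sq_nonneg x, sq_nonneg y]
    exact hxy (by rw [hx, hy])
  have hr : 0 < √(x ^ 2 + y ^ 2) := Real.sqrt_pos.2 hpos
  have hsq := Real.sq_sqrt hpos.le
  set r := √(x ^ 2 + y ^ 2)
  have h := hf.homogeneous r hr (x / r) (y / r)
  rw [mul_div_cancel₀ _ hr.ne', mul_div_cancel₀ _ hr.ne'] at h
  have hb := hA (x / r, y / r) (by
    change (x / r) ^ 2 + (y / r) ^ 2 = 1
    rw [div_pow, div_pow, ← add_div, hsq, div_self hpos.ne'])
  rw [← h, norm_mul, norm_pow, Complex.norm_real, Real.norm_of_nonneg hr.le] at hb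
  exact hb

end SmoothHomogeneous

lemma contDiff_comp_abs {φ : ℝ → ℂ} (hφ : ContDiffOn ℝ (⊤ : ℕ∞) φ (Set.Ici 0)) {δ : ℝ}
    (hδ : 0 < δ) {c : ℂ} (hc : ∀ t : ℝ, 0 ≤ t → t ≤ δ → φ t = c) :
    ContDiff ℝ (⊤ : ℕ∞) fun u : ℝ => φ |u| := by
  refine contDiff_iff_contDiffAt.2 fun u => ?_
  rcases eq_or_ne u 0 with rfl | hu
  · refine (contDiffAt_const (c := c)).congr_of_eventuallyEq ?_
    filter_upwards [Metric.ball_mem_nhds (0 : ℝ) hδ] with v hv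
    rw [mem_ball_zero_iff, Real.norm_eq_abs] at hv
    exact hc _ (abs_nonneg v) hv.le
  · exact (hφ.contDiffAt (Ici_mem_nhds (abs_pos.2 hu))).comp u (contDiffAt_abs hu)

lemma mSymb_homogeneous (s : ℝ) (φ : ℝ → ℂ) {t : ℝ} (ht : 0 < t) (x y : ℝ) :
    mSymb s φ (t * x) (t * y) = mSymb s φ x y := by
  have h : ∀ a b : ℝ, |t * a| / |t * b| = |a| / |b| := fun a b => by
    rw [abs_mul, abs_mul, mul_div_mul_left _ _ (abs_pos.2 ht.ne').ne']
  simp only [mSymb, ← mul_add, h, mul_eq_zero, ht.ne', false_or]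

lemma mSymb_eq_zero (s : ℝ) {φ : ℝ → ℂ} (hφ0 : ∀ t : ℝ, 1 / 2 ≤ t → φ t = 0) {x y : ℝ}
    (h : |x| ≤ 2 * |y|) : mSymb s φ x y = 0 := by
  unfold mSymb
  split_ifs with hx
  · rfl
  · rw [hφ0, mul_zero]
    rw [le_div_iff₀ (abs_pos.2 hx)]
    linarith

lemma contDiffOn_mSymb (s : ℝ) {φ : ℝ → ℂ} (hφ : ContDiffOn ℝ (⊤ : ℕ∞) φ (Set.Ici 0))
    (hφ1 : ∀ t : ℝ, 0 ≤ t → t ≤ 1 / 4 → φ t = 1) (hφ0 : ∀ t : ℝ, 1 / 2 ≤ t → φ t = 0) :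
    ContDiffOn ℝ (⊤ : ℕ∞) (fun q : ℝ × ℝ => mSymb s φ q.1 q.2) {q : ℝ × ℝ | q ≠ 0} := by
  intro q hq
  refine ContDiffAt.contDiffWithinAt ?_
  rcases lt_or_ge |q.1| (2 * |q.2|) with h | h
  · refine (contDiffAt_const (c := (0 : ℂ))).congr_of_eventuallyEq ?_
    have ho : IsOpen {p : ℝ × ℝ | |p.1| < 2 * |p.2|} := isOpen_lt (by fun_prop) (by fun_prop)
    filter_upwards [ho.mem_nhds h] with p hp
    exact mSymb_eq_zero s hφ0 (le_of_lt hp)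
  · have hx : q.1 ≠ 0 := fun hx => hq (by
      rw [hx, abs_zero] at h
      exact Prod.ext hx (abs_eq_zero.1 (by linarith [abs_nonneg q.2])))
    have hlt : |q.2| < |q.1| := by linarith [abs_pos.2 hx, abs_nonneg q.2]
    have hu : ContDiffAt ℝ (⊤ : ℕ∞) (fun p : ℝ × ℝ => p.2 / p.1) q :=
      contDiffAt_snd.div contDiffAt_fst hx
    have hpos : ∀ p : ℝ × ℝ, |p.2| < |p.1| → 0 < 1 + p.2 / p.1 := fun p hp => by
      have : |p.2 / p.1| < 1 := by
        rw [abs_div, div_lt_one ((abs_nonneg _).trans_lt hp)]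
        exact hp
      linarith [(abs_lt.1 this).1]
    have hψ := ((contDiff_comp_abs hφ (by norm_num) hφ1).contDiffAt (x := q.2 / q.1)).comp q hu
    have hg : ContDiffAt ℝ (⊤ : ℕ∞)
        (fun p : ℝ × ℝ => (((1 + p.2 / p.1) ^ (2 * s) : ℝ) : ℂ)) q :=
      Complex.ofRealCLM.contDiff.contDiffAt.comp q
        ((contDiffAt_const.add hu).rpow_const_of_ne (hpos q hlt).ne')
    refine (hg.mul hψ).congr_of_eventuallyEq ?_
    have ho : IsOpen {p : ℝ × ℝ | |p.2| < |p.1|} := isOpen_lt (by fun_prop) (by fun_prop)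
    filter_upwards [ho.mem_nhds hlt] with p hp
    have hp1 : p.1 ≠ 0 := abs_pos.1 ((abs_nonneg _).trans_lt hp)
    have h1 : |p.1 + p.2| / |p.1| = 1 + p.2 / p.1 := by
      rw [← abs_div, add_div, div_self hp1, abs_of_pos (hpos p hp)]
    simp only [mSymb, if_neg hp1, h1, ← abs_div, Function.comp_apply]

/-- **The paraproduct symbol satisfies the Mikhlin–Hörmander condition of every order on
`ℝ²`:** if `s > 0` and `φ` is smooth on `[0,∞)` with `φ ≡ 1` on `[0,1/4]` and `φ ≡ 0` on
`[1/2,∞)`, then `m(ξ) = (|ξ₁+ξ₂|/|ξ₁|)^{2s} φ(|ξ₂|/|ξ₁|)` is `C^∞` on `ℝ² ∖ {0}` and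
`sup_{ξ ≠ 0} |ξ|^{|α|} |∂^α m(ξ)| < ∞` for every multi-index `α`. -/
theorem stmt18 (s : ℝ) (hs : 0 < s) (φ : ℝ → ℂ)
    (hφ : ContDiffOn ℝ (⊤ : ℕ∞) φ (Set.Ici 0))
    (hφ1 : ∀ t : ℝ, 0 ≤ t → t ≤ 1 / 4 → φ t = 1)
    (hφ0 : ∀ t : ℝ, 1 / 2 ≤ t → φ t = 0) :
    ContDiffOn ℝ (⊤ : ℕ∞) (fun q : ℝ × ℝ => mSymb s φ q.1 q.2) {q : ℝ × ℝ | q ≠ 0} ∧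
    ∀ a b : ℕ, ∃ A : ℝ, ∀ x y : ℝ, (x, y) ≠ ((0 : ℝ), (0 : ℝ)) →
      Real.sqrt (x ^ 2 + y ^ 2) ^ (a + b) * ‖mpd a b (mSymb s φ) x y‖ ≤ A := by
  have hm : SmoothHomogeneous 0 (mSymb s φ) :=
    ⟨contDiffOn_mSymb s hφ hφ1 hφ0, fun t ht x y => by
      rw [pow_zero, one_mul, mSymb_homogeneous s φ ht]⟩
  refine ⟨hm.contDiffOn, fun a b => ?_⟩
  have h := (hm.mpd a b).exists_bound
  rwa [zero_add] at h
end

section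
/- Let s > 0 be real, let φ : [0,∞) → ℂ be a C^∞ function with φ(t) = 1 for t ∈ [0, 1/4] and φ(t) = 0 for t ≥ 1/2, and let η₀ : [0,∞) → ℂ be a C^∞ function with supp η₀ ⊆ [0, 1/4]. Define m : (0,∞)² → ℂ by m(λ₁,λ₂) := ( λ₁ (1 − λ₂²/4)^{1/2} + λ₂ (1 − λ₁²/4)^{1/2} )^{2s} · λ₁^{−2s} · φ(λ₂/λ₁) · η₀(λ₁) η₀(λ₂). Then m is smooth on (0,∞)² and for every multi-index α ∈ ℕ² one has sup_{λ ∈ (0,∞)²} |λ|^{|α|} |∂^α m(λ)| < ∞; that is, m satisfies the Mikhlin–Hörmander condition of every order on (0,∞)². -/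
open Real

/-- The symbol `m^s_{1,1}` used in the proof of the fractional Leibniz rule for the
discrete Laplacian on `ℤ`:
`m(λ) = (λ₁√(1-λ₂²/4) + λ₂√(1-λ₁²/4))^{2s} λ₁^{-2s} φ(λ₂/λ₁) η₀(λ₁) η₀(λ₂)`. -/
noncomputable def mSymb11 (s : ℝ) (φ η₀ : ℝ → ℂ) (x y : ℝ) : ℂ :=
  (((x * Real.sqrt (1 - y ^ 2 / 4) + y * Real.sqrt (1 - x ^ 2 / 4)) ^ (2 * s) : ℝ) : ℂ) /
      ((x ^ (2 * s) : ℝ) : ℂ) *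
    φ (y / x) * η₀ x * η₀ y

/-- The closed octant `[0,∞)³`. -/
def octant : Set (ℝ × ℝ × ℝ) := Set.Ici 0 ×ˢ Set.Ici 0 ×ˢ Set.Ici 0

theorem uniqueDiffOn_octant : UniqueDiffOn ℝ octant :=
  (uniqueDiffOn_Ici 0).prod ((uniqueDiffOn_Ici 0).prod (uniqueDiffOn_Ici 0))

theorem octant_mem_nhds {x y w : ℝ} (hx : 0 < x) (hy : 0 < y) (hw : 0 < w) :
    octant ∈ nhds (x, y, w) :=
  prod_mem_nhds (Ici_mem_nhds hx) (prod_mem_nhds (Ici_mem_nhds hy) (Ici_mem_nhds hw))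

/-- The region outside the cube `(-∞,1]³`. -/
def outsideCube : Set (ℝ × ℝ × ℝ) := {p | 1 < p.1 ∨ 1 < p.2.1 ∨ 1 < p.2.2}

theorem isOpen_outsideCube : IsOpen outsideCube :=
  (isOpen_lt continuous_const continuous_fst).union
    ((isOpen_lt continuous_const (continuous_fst.comp continuous_snd)).union
      (isOpen_lt continuous_const (continuous_snd.comp continuous_snd)))

/-- Smooth functions on the closed octant which vanish outside the unit cube. -/
structure OctantTest (F : ℝ × ℝ × ℝ → ℂ) : Prop where
  contDiffOn : ContDiffOn ℝ (⊤ : ℕ∞) F octant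
  eq_zero : ∀ p ∈ octant, p ∈ outsideCube → F p = 0

namespace OctantTest

variable {F G : ℝ × ℝ × ℝ → ℂ}

theorem add (hF : OctantTest F) (hG : OctantTest G) : OctantTest (fun p => F p + G p) where
  contDiffOn := hF.contDiffOn.add hG.contDiffOn
  eq_zero p hp ho := by rw [hF.eq_zero p hp ho, hG.eq_zero p hp ho, add_zero]

theorem smul {c : ℝ × ℝ × ℝ → ℝ} (hc : ContDiff ℝ (⊤ : ℕ∞) c) (hF : OctantTest F) :
    OctantTest (fun p => c p • F p) where
  contDiffOn := hc.contDiffOn.smul hF.contDiffOn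
  eq_zero p hp ho := by rw [hF.eq_zero p hp ho, smul_zero]

theorem fderivWithin_apply (hF : OctantTest F) (v : ℝ × ℝ × ℝ) :
    OctantTest (fun p => fderivWithin ℝ F octant p v) where
  contDiffOn :=
    (hF.contDiffOn.fderivWithin uniqueDiffOn_octant (by norm_cast)).clm_apply contDiffOn_const
  eq_zero p hp ho := by
    have h : F =ᶠ[nhdsWithin p octant] fun _ => 0 := by
      filter_upwards [self_mem_nhdsWithin,
        mem_nhdsWithin_of_mem_nhds (isOpen_outsideCube.mem_nhds ho)] with q hq hq'
      exact hF.eq_zero q hq hq'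
    rw [h.fderivWithin_eq (hF.eq_zero p hp ho)]
    simp

theorem bounded (hF : OctantTest F) : ∃ A : ℝ, ∀ p ∈ octant, ‖F p‖ ≤ A := by
  have hK : IsCompact (Set.Icc (0 : ℝ) 1 ×ˢ Set.Icc (0 : ℝ) 1 ×ˢ Set.Icc (0 : ℝ) 1) :=
    isCompact_Icc.prod (isCompact_Icc.prod isCompact_Icc)
  obtain ⟨A, hA⟩ := hK.exists_bound_of_continuousOn (f := F)
    (hF.contDiffOn.continuousOn.mono
      (Set.prod_mono Set.Icc_subset_Ici_self
        (Set.prod_mono Set.Icc_subset_Ici_self Set.Icc_subset_Ici_self)))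
  refine ⟨max A 0, fun p hp => ?_⟩
  by_cases ho : p ∈ outsideCube
  · simp [hF.eq_zero p hp ho]
  · simp only [outsideCube, Set.mem_ofPred_eq, not_or, not_lt] at ho
    exact (hA p ⟨⟨hp.1, ho.1⟩, ⟨hp.2.1, ho.2.1⟩, ⟨hp.2.2, ho.2.2⟩⟩).trans (le_max_left _ _)

theorem hasFDerivAt (hF : OctantTest F) {x y w : ℝ} (hx : 0 < x) (hy : 0 < y) (hw : 0 < w) :
    HasFDerivAt F (fderivWithin ℝ F octant (x, y, w)) (x, y, w) :=
  ((hF.contDiffOn.differentiableOn (by simp) _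
    (mem_of_mem_nhds (octant_mem_nhds hx hy hw))).hasFDerivWithinAt).hasFDerivAt
      (octant_mem_nhds hx hy hw)

end OctantTest

/-- Functions on the open quadrant of the form `x⁻ⁿ F(x, y, y/x)` with `F` smooth on the closed
octant and vanishing outside the unit cube. -/
def IsConeSymbol (n : ℕ) (f : ℝ → ℝ → ℂ) : Prop :=
  ∃ F, OctantTest F ∧ ∀ x y : ℝ, 0 < x → 0 < y → f x y = (x ^ n)⁻¹ • F (x, y, y / x)

theorem IsConeSymbol.pd1 {n : ℕ} {f : ℝ → ℝ → ℂ} (hf : IsConeSymbol n f) :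
    IsConeSymbol (n + 1) (pd1 f) := by
  obtain ⟨F, hF, hfF⟩ := hf
  refine ⟨fun p => (p.1 • fderivWithin ℝ F octant p (1, 0, 0) +
      (-p.2.2) • fderivWithin ℝ F octant p (0, 0, 1)) + (-(n : ℝ)) • F p,
    ((OctantTest.smul contDiff_fst (hF.fderivWithin_apply _)).add
      (OctantTest.smul (contDiff_snd.comp contDiff_snd).neg (hF.fderivWithin_apply _))).add
      (OctantTest.smul contDiff_const hF), fun x y hx hy => ?_⟩
  have hγ : HasDerivAt (fun t : ℝ => (t, y, y / t)) (1, 0, -y / x ^ 2) x :=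
    (hasDerivAt_id x).prodMk ((hasDerivAt_const x y).prodMk
      (by simpa using (hasDerivAt_const x y).fun_div (hasDerivAt_id x) hx.ne'))
  have h1 := (hF.hasFDerivAt hx hy (div_pos hy hx)).comp_hasDerivAt x hγ
  have h2 : HasDerivAt (fun t : ℝ => (t ^ n)⁻¹) (-(n : ℝ) * (x ^ (n + 1))⁻¹) x := by
    refine (((hasDerivAt_pow n x).fun_inv (pow_ne_zero n hx.ne'))).congr_deriv ?_
    rcases n with _ | n
    · simp
    · rw [Nat.add_sub_cancel]
      field_simp
      ring
  have h3 := h2.fun_smul h1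
  have hev : (fun t => f t y) =ᶠ[nhds x] fun t => (t ^ n)⁻¹ • (F ∘ fun t => (t, y, y / t)) t := by
    filter_upwards [lt_mem_nhds hx] with t ht
    exact hfF t y ht hy
  have hv : ((1, 0, -y / x ^ 2) : ℝ × ℝ × ℝ) = (1, 0, 0) + (-y / x ^ 2) • (0, 0, 1) := by
    simp
  rw [_root_.pd1, (h3.congr_of_eventuallyEq hev).deriv, hv, map_add, map_smul]
  simp only [Function.comp_apply, smul_add, smul_smul]
  congr 1
  · congr 2 <;> (field_simp; ring)
  · congr 1
    ring

theorem IsConeSymbol.pd2 {n : ℕ} {f : ℝ → ℝ → ℂ} (hf : IsConeSymbol n f) :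
    IsConeSymbol (n + 1) (pd2 f) := by
  obtain ⟨F, hF, hfF⟩ := hf
  refine ⟨fun p => p.1 • fderivWithin ℝ F octant p (0, 1, 0) +
      fderivWithin ℝ F octant p (0, 0, 1),
    (OctantTest.smul contDiff_fst (hF.fderivWithin_apply _)).add (hF.fderivWithin_apply _),
    fun x y hx hy => ?_⟩
  have hγ : HasDerivAt (fun t : ℝ => (x, t, t / x)) (0, 1, 1 / x) y :=
    (hasDerivAt_const y x).prodMk ((hasDerivAt_id y).prodMk ((hasDerivAt_id y).div_const x))
  have h1 := ((hF.hasFDerivAt hx hy (div_pos hy hx)).comp_hasDerivAt y hγ).const_smul (x ^ n)⁻¹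
  have hev : (fun t => f x t) =ᶠ[nhds y]
      fun t => (x ^ n)⁻¹ • (F ∘ fun t => (x, t, t / x)) t := by
    filter_upwards [lt_mem_nhds hy] with t ht
    exact hfF x t hx ht
  have hv : ((0, 1, 1 / x) : ℝ × ℝ × ℝ) = (0, 1, 0) + (1 / x) • (0, 0, 1) := by
    simp
  rw [_root_.pd2, (h1.congr_of_eventuallyEq hev).deriv, hv, map_add, map_smul]
  simp only [smul_add, smul_smul]
  congr 2 <;> (field_simp; ring)

theorem IsConeSymbol.mpd {n : ℕ} {f : ℝ → ℝ → ℂ} (hf : IsConeSymbol n f) (a b : ℕ) :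
    IsConeSymbol (n + b + a) (mpd a b f) := by
  have h2 : IsConeSymbol (n + b) (_root_.pd2^[b] f) := by
    induction b with
    | zero => exact hf
    | succ b ih =>
      rw [Function.iterate_succ_apply']
      exact ih.pd2
  unfold _root_.mpd
  induction a with
  | zero => exact h2
  | succ a ih =>
    rw [Function.iterate_succ_apply']
    exact ih.pd1

theorem IsConeSymbol.bounded {n : ℕ} {f : ℝ → ℝ → ℂ} (hf : IsConeSymbol n f) :
    ∃ A : ℝ, ∀ x y : ℝ, 0 < x → 0 < y → √(x ^ 2 + y ^ 2) ^ n * ‖f x y‖ ≤ A := by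
  obtain ⟨F, hF, hfF⟩ := hf
  obtain ⟨A, hA⟩ := hF.bounded
  refine ⟨2 ^ n * A, fun x y hx hy => ?_⟩
  have hw : 0 < y / x := div_pos hy hx
  have hp : (x, y, y / x) ∈ octant := ⟨hx.le, hy.le, hw.le⟩
  have hA0 : 0 ≤ A := (norm_nonneg _).trans (hA _ hp)
  rw [hfF x y hx hy]
  by_cases h : 1 < y / x
  · rw [hF.eq_zero _ hp (Or.inr (Or.inr h))]
    simp only [smul_zero, norm_zero, mul_zero]
    positivity
  · have hyx : y ≤ x := (div_le_one hx).1 (not_lt.1 h)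
    have hr : √(x ^ 2 + y ^ 2) ≤ 2 * x := Real.sqrt_le_iff.2 ⟨by positivity, by nlinarith⟩
    rw [norm_smul, Real.norm_of_nonneg (by positivity)]
    calc √(x ^ 2 + y ^ 2) ^ n * ((x ^ n)⁻¹ * ‖F (x, y, y / x)‖)
        ≤ (2 * x) ^ n * ((x ^ n)⁻¹ * A) := by
          gcongr
          exact hA _ hp
      _ = 2 ^ n * A := by
          rw [mul_pow]
          field_simp

theorem IsConeSymbol.contDiffOn {n : ℕ} {f : ℝ → ℝ → ℂ} (hf : IsConeSymbol n f) :
    ContDiffOn ℝ (⊤ : ℕ∞) (fun q : ℝ × ℝ => f q.1 q.2) (Set.Ioi 0 ×ˢ Set.Ioi 0) := by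
  obtain ⟨F, hF, hfF⟩ := hf
  have hne : ∀ q ∈ (Set.Ioi 0 ×ˢ Set.Ioi 0 : Set (ℝ × ℝ)), q.1 ≠ 0 := fun q hq => hq.1.ne'
  have hγ : ContDiffOn ℝ (⊤ : ℕ∞) (fun q : ℝ × ℝ => (q.1, q.2, q.2 / q.1))
      (Set.Ioi 0 ×ˢ Set.Ioi 0) :=
    contDiffOn_fst.prodMk (contDiffOn_snd.prodMk (contDiffOn_snd.div contDiffOn_fst hne))
  refine (((contDiffOn_fst.pow n).inv fun q hq => pow_ne_zero n (hne q hq)).smul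
    (hF.contDiffOn.comp hγ fun q hq => ?_)).congr fun q hq => hfF q.1 q.2 hq.1 hq.2
  obtain ⟨h1, h2⟩ : 0 < q.1 ∧ 0 < q.2 := hq
  exact ⟨Set.mem_Ici.2 h1.le, Set.mem_Ici.2 h2.le, Set.mem_Ici.2 (div_pos h2 h1).le⟩

/-- The function `F` with `mSymb11 s φ η₀ x y = F (x, y, y / x)`. -/
noncomputable def liftedSymb (s : ℝ) (φ η₀ : ℝ → ℂ) (p : ℝ × ℝ × ℝ) : ℂ :=
  (((√(1 - p.2.1 ^ 2 / 4) + p.2.2 * √(1 - p.1 ^ 2 / 4)) ^ (2 * s) : ℝ) : ℂ) *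
    φ p.2.2 * η₀ p.1 * η₀ p.2.1

theorem mSymb11_eq_liftedSymb (s : ℝ) (φ η₀ : ℝ → ℂ) {x y : ℝ} (hx : 0 < x) (hy : 0 < y) :
    mSymb11 s φ η₀ x y = liftedSymb s φ η₀ (x, y, y / x) := by
  have h : x * √(1 - y ^ 2 / 4) + y * √(1 - x ^ 2 / 4) =
      x * (√(1 - y ^ 2 / 4) + y / x * √(1 - x ^ 2 / 4)) := by
    field_simp
  have hpos : (x ^ (2 * s) : ℝ) ≠ 0 := (Real.rpow_pos_of_pos hx _).ne'
  rw [mSymb11, liftedSymb, h, Real.mul_rpow hx.le (by positivity), Complex.ofReal_mul,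
    mul_div_cancel_left₀ _ (Complex.ofReal_ne_zero.2 hpos)]

theorem octantTest_liftedSymb (s : ℝ) {φ η₀ : ℝ → ℂ}
    (hφ : ContDiffOn ℝ (⊤ : ℕ∞) φ (Set.Ici 0)) (hφ0 : ∀ t : ℝ, 1 ≤ t → φ t = 0)
    (hη : ContDiffOn ℝ (⊤ : ℕ∞) η₀ (Set.Ici 0)) (hη0 : ∀ t : ℝ, 1 ≤ t → η₀ t = 0) :
    OctantTest (liftedSymb s φ η₀) := by
  have hzero : ∀ p ∈ outsideCube, liftedSymb s φ η₀ p = 0 := by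
    rintro p (h | h | h)
    · simp [liftedSymb, hη0 _ h.le]
    · simp [liftedSymb, hη0 _ h.le]
    · simp [liftedSymb, hφ0 _ h.le]
  refine ⟨fun p hp => ?_, fun p _ ho => hzero p ho⟩
  by_cases ho : p ∈ outsideCube
  · refine (contDiffAt_const (c := (0 : ℂ))).congr_of_eventuallyEq ?_ |>.contDiffWithinAt
    filter_upwards [isOpen_outsideCube.mem_nhds ho] with q hq using hzero q hq
  · simp only [outsideCube, Set.mem_ofPred_eq, not_or, not_lt] at ho
    obtain ⟨h1, h2, h3⟩ := ho
    obtain ⟨hp1, hp2, hp3⟩ := hp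
    simp only [Set.mem_Ici] at hp1 hp2 hp3
    have hx : 0 < 1 - p.1 ^ 2 / 4 := by nlinarith
    have hy : 0 < 1 - p.2.1 ^ 2 / 4 := by nlinarith
    have hbase : √(1 - p.2.1 ^ 2 / 4) + p.2.2 * √(1 - p.1 ^ 2 / 4) ≠ 0 := by
      have := Real.sqrt_pos.2 hy
      positivity
    have hsx : ContDiffAt ℝ (⊤ : ℕ∞) (fun p : ℝ × ℝ × ℝ => √(1 - p.1 ^ 2 / 4)) p :=
      ContDiffAt.sqrt (by fun_prop) hx.ne'
    have hsy : ContDiffAt ℝ (⊤ : ℕ∞) (fun p : ℝ × ℝ × ℝ => √(1 - p.2.1 ^ 2 / 4)) p :=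
      ContDiffAt.sqrt (by fun_prop) hy.ne'
    have hrpow : ContDiffAt ℝ (⊤ : ℕ∞) (fun p : ℝ × ℝ × ℝ =>
        (√(1 - p.2.1 ^ 2 / 4) + p.2.2 * √(1 - p.1 ^ 2 / 4)) ^ (2 * s)) p :=
      (hsy.add ((contDiff_snd.comp contDiff_snd).contDiffAt.mul hsx)).rpow_const_of_ne hbase
    have hpow : ContDiffWithinAt ℝ (⊤ : ℕ∞) (fun p : ℝ × ℝ × ℝ =>
        (((√(1 - p.2.1 ^ 2 / 4) + p.2.2 * √(1 - p.1 ^ 2 / 4)) ^ (2 * s) : ℝ) : ℂ)) octant p :=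
      (Complex.ofRealCLM.contDiff.contDiffAt.comp p hrpow).contDiffWithinAt
    have hφ' : ContDiffWithinAt ℝ (⊤ : ℕ∞) (fun p : ℝ × ℝ × ℝ => φ p.2.2) octant p :=
      (hφ p.2.2 hp3).comp p (contDiff_snd.comp contDiff_snd).contDiffWithinAt
        fun q hq => hq.2.2
    have hη1 : ContDiffWithinAt ℝ (⊤ : ℕ∞) (fun p : ℝ × ℝ × ℝ => η₀ p.1) octant p :=
      (hη p.1 hp1).comp p contDiff_fst.contDiffWithinAt fun q hq => hq.1
    have hη2 : ContDiffWithinAt ℝ (⊤ : ℕ∞) (fun p : ℝ × ℝ × ℝ => η₀ p.2.1) octant p :=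
      (hη p.2.1 hp2).comp p (contDiff_fst.comp contDiff_snd).contDiffWithinAt
        fun q hq => hq.2.1
    exact ((hpow.mul hφ').mul hη1).mul hη2

/-- **The symbol `m^s_{1,1}` satisfies the Mikhlin–Hörmander condition of every order on
`(0,∞)²`:** if `s > 0`, `φ` is smooth on `[0,∞)` with `φ ≡ 1` on `[0,1/4]`, `φ ≡ 0` on
`[1/2,∞)`, and `η₀` is smooth on `[0,∞)` with support in `[0,1/4]`, then `m^s_{1,1}` is
smooth on `(0,∞)²` and `sup_{λ ∈ (0,∞)²} |λ|^{|α|} |∂^α m(λ)| < ∞` for every `α`. -/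
theorem stmt19 (s : ℝ) (hs : 0 < s) (φ η₀ : ℝ → ℂ)
    (hφ : ContDiffOn ℝ (⊤ : ℕ∞) φ (Set.Ici 0))
    (hφ1 : ∀ t : ℝ, 0 ≤ t → t ≤ 1 / 4 → φ t = 1)
    (hφ0 : ∀ t : ℝ, 1 / 2 ≤ t → φ t = 0)
    (hη : ContDiffOn ℝ (⊤ : ℕ∞) η₀ (Set.Ici 0))
    (hηsupp : ∀ t : ℝ, t ∉ Set.Icc (0 : ℝ) (1 / 4) → η₀ t = 0) :
    ContDiffOn ℝ (⊤ : ℕ∞) (fun q : ℝ × ℝ => mSymb11 s φ η₀ q.1 q.2)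
      (Set.Ioi 0 ×ˢ Set.Ioi 0) ∧
    ∀ a b : ℕ, ∃ A : ℝ, ∀ x y : ℝ, 0 < x → 0 < y →
      Real.sqrt (x ^ 2 + y ^ 2) ^ (a + b) * ‖mpd a b (mSymb11 s φ η₀) x y‖ ≤ A := by
  have h : IsConeSymbol 0 (mSymb11 s φ η₀) :=
    ⟨liftedSymb s φ η₀,
      octantTest_liftedSymb s hφ (fun t ht => hφ0 t (by linarith)) hη
        (fun t ht => hηsupp t fun h => by linarith [h.2]),
      fun x y hx hy => by simpa using mSymb11_eq_liftedSymb s φ η₀ hx hy⟩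
  refine ⟨h.contDiffOn, fun a b => ?_⟩
  have hab := (h.mpd a b).bounded
  rwa [zero_add, add_comm b a] at hab
end
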